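/- Let σ be drawn from the quadratic interaction model ℙ, assume ‖A_n‖_4 ≤ ρ ∈ (0,1), let q ∈ ℝⁿ with ‖q‖_2 = 1, assume υ_n := Σ_i q_i² ψ_i''(c_i) ≥ κ > 0, fix λ_n with |λ_n| ≤ ρ, set ε := A_n q − λ_n q, and let W_n be a centered Gaussian with variance υ_n/(1 − λ_n υ_n). Then there is a constant C depending only on ρ and κ such that d_KS( Σ_i q_i(σ_i − ψ_i'(c_i)/(1 − λ_n υ_n)), W_n ) ≤ C·( √R_{2n}·(√R_{1n} + √α_n + ‖ε‖₂) + √R_{1n} + √R_{3n} + √n·α_n + ‖q‖_∞ + R_{4n} + |εᵀΨ'(c)| + ‖ε‖₂ ), where ν_i := Σ_j A_n(i,j) ψ_j'(c_j), R_{1n} := Σ_i (Σ_j A_n(i,j) q_j (ψ_j''(c_j) − υ_n))², R_{2n} := Σ_i ν_i², R_{3n} := Σ_i ν_i⁴, R_{4n} := |Σ_{i,j} A_n(i,j) q_i (ψ_i''(c_i) − υ_n) ψ_j'(c_j)|, and Ψ'(c) := (ψ_1'(c_1),…,ψ_n'(c_n))ᵀ. -/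

import Mathlib

open MeasureTheory ProbabilityTheory Filter Matrix Set
open scoped ENNReal NNReal BigOperators Topology

noncomputable section

/-- The ℓ^r norm of a vector in ℝⁿ (sup-norm when `r = ∞`). -/
def pNorm {n : ℕ} (r : ℝ≥0∞) (v : Fin n → ℝ) : ℝ :=
  if r = ∞ then ⨆ i, |v i| else (∑ i, |v i| ^ r.toReal) ^ (1 / r.toReal)

/-- The (r,r)-operator norm of a square real matrix. -/
def opNorm {n : ℕ} (r : ℝ≥0∞) (M : Matrix (Fin n) (Fin n) ℝ) : ℝ :=
  sSup {x | ∃ v : Fin n → ℝ, pNorm r v ≤ 1 ∧ x = pNorm r (M.mulVec v)}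

/-- Log-moment generating function of a measure on ℝ. -/
def logMGF (ν : Measure ℝ) (θ : ℝ) : ℝ := Real.log (∫ z, Real.exp (θ * z) ∂ν)

/-- ψ' -/
def psiD (ν : Measure ℝ) : ℝ → ℝ := deriv (logMGF ν)

/-- ψ'' -/
def psiDD (ν : Measure ℝ) : ℝ → ℝ := deriv (deriv (logMGF ν))

/-- φ, the inverse of ψ'. -/
def phiFn (ν : Measure ℝ) : ℝ → ℝ := Function.invFun (psiD ν)

/-- Rate function I(z) = z φ(z) − ψ(φ(z)). -/
def rateFn (ν : Measure ℝ) (z : ℝ) : ℝ := z * phiFn ν z - logMGF ν (phiFn ν z)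

/-- Base-measure assumptions: a non-degenerate probability measure supported on [-1,1]
with both -1 and 1 in its support. -/
structure GoodBase (ν : Measure ℝ) : Prop where
  prob : IsProbabilityMeasure ν
  supp : ν (Set.Icc (-1 : ℝ) 1)ᶜ = 0
  one_cluster : ∀ ε : ℝ, 0 < ε → 0 < ν (Set.Ioc (1 - ε) 1)
  negone_cluster : ∀ ε : ℝ, 0 < ε → 0 < ν (Set.Ico (-1 : ℝ) (-1 + ε))

/-- Hamiltonian ½ σᵀAσ + cᵀσ. -/
def ham {n : ℕ} (A : Matrix (Fin n) (Fin n) ℝ) (c σ : Fin n → ℝ) : ℝ :=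
  (1 / 2) * ∑ i, σ i * A.mulVec σ i + ∑ i, c i * σ i

/-- The quadratic interaction (Gibbs) measure. -/
def gibbs {n : ℕ} (μ : Fin n → Measure ℝ) (A : Matrix (Fin n) (Fin n) ℝ) (c : Fin n → ℝ) :
    Measure (Fin n → ℝ) :=
  (ENNReal.ofReal (∫ σ, Real.exp (ham A c σ) ∂(Measure.pi μ)))⁻¹ •
    ((Measure.pi μ).withDensity fun σ => ENNReal.ofReal (Real.exp (ham A c σ)))

/-- The cube [-1,1]ⁿ. -/
def cube (n : ℕ) : Set (Fin n → ℝ) := {z | ∀ i, z i ∈ Set.Icc (-1 : ℝ) 1}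

/-- Mean-field functional F(z) = ½ zᵀAz + cᵀz − Σ I_i(z_i). -/
def mfF {n : ℕ} (μ : Fin n → Measure ℝ) (A : Matrix (Fin n) (Fin n) ℝ) (c z : Fin n → ℝ) : ℝ :=
  (1 / 2) * ∑ i, z i * A.mulVec z i + ∑ i, c i * z i - ∑ i, rateFn (μ i) (z i)

/-- Being a mean-field maximizer over the cube. -/
def IsMFMax {n : ℕ} (μ : Fin n → Measure ℝ) (A : Matrix (Fin n) (Fin n) ℝ) (c u : Fin n → ℝ) :
    Prop := u ∈ cube n ∧ IsMaxOn (mfF μ A c) (cube n) u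

open scoped Classical in
/-- The mean-field maximizer (chosen by choice when one exists). -/
def mfMax {n : ℕ} (μ : Fin n → Measure ℝ) (A : Matrix (Fin n) (Fin n) ℝ) (c : Fin n → ℝ) :
    Fin n → ℝ :=
  if h : ∃ u, IsMFMax μ A c u then h.choose else 0

/-- α_n = max_i Σ_j A(i,j)². -/
def alphaMax {n : ℕ} (A : Matrix (Fin n) (Fin n) ℝ) : ℝ := ⨆ i, ∑ j, A i j ^ 2

/-- Kolmogorov-Smirnov distance between two laws on ℝ. -/
def dKS (μ ν : Measure ℝ) : ℝ :=
  ⨆ t : ℝ, |(μ (Set.Iic t)).toReal - (ν (Set.Iic t)).toReal|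

/-- υ_n = Σ_i q_i² ψ''_i(c_i). -/
def upsilonQ {n : ℕ} (μ : Fin n → Measure ℝ) (c q : Fin n → ℝ) : ℝ :=
  ∑ i, q i ^ 2 * psiDD (μ i) (c i)

/-- ν_i = Σ_j A(i,j) ψ'_j(c_j). -/
def nuVec {n : ℕ} (μ : Fin n → Measure ℝ) (A : Matrix (Fin n) (Fin n) ℝ) (c : Fin n → ℝ) :
    Fin n → ℝ := fun i => ∑ j, A i j * psiD (μ j) (c j)

def R1 {n : ℕ} (μ : Fin n → Measure ℝ) (A : Matrix (Fin n) (Fin n) ℝ) (c q : Fin n → ℝ) : ℝ :=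
  ∑ i, (∑ j, A i j * q j * (psiDD (μ j) (c j) - upsilonQ μ c q)) ^ 2

def R2 {n : ℕ} (μ : Fin n → Measure ℝ) (A : Matrix (Fin n) (Fin n) ℝ) (c : Fin n → ℝ) : ℝ :=
  ∑ i, nuVec μ A c i ^ 2

def R3 {n : ℕ} (μ : Fin n → Measure ℝ) (A : Matrix (Fin n) (Fin n) ℝ) (c : Fin n → ℝ) : ℝ :=
  ∑ i, nuVec μ A c i ^ 4

def R4 {n : ℕ} (μ : Fin n → Measure ℝ) (A : Matrix (Fin n) (Fin n) ℝ) (c q : Fin n → ℝ) : ℝ :=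
  |∑ i, ∑ j, A i j * q i * (psiDD (μ i) (c i) - upsilonQ μ c q) * psiD (μ j) (c j)|

/-- ε = A q − λ q. -/
def epsVec {n : ℕ} (A : Matrix (Fin n) (Fin n) ℝ) (q : Fin n → ℝ) (lam : ℝ) : Fin n → ℝ :=
  fun i => A.mulVec q i - lam * q i

/-- Product of two measures via bind (the joint law of an independent pair). -/
def mprod {α β : Type*} [MeasurableSpace α] [MeasurableSpace β]
    (μ : Measure α) (ν : Measure β) : Measure (α × β) :=
  μ.bind fun a => ν.map (Prod.mk a)

abbrev pairIdx (n : ℕ) := {ij : Fin n × Fin n // ij.1 < ij.2}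

/-- Bernoulli(p) as a measure on ℝ (point masses at 0 and 1). -/
def bern (p : ℝ) : Measure ℝ :=
  ENNReal.ofReal (1 - p) • Measure.dirac 0 + ENNReal.ofReal p • Measure.dirac 1

/-- Symmetrization of edge indicators into an adjacency function with zero diagonal. -/
def symFun {n : ℕ} (w : pairIdx n → ℝ) : Fin n → Fin n → ℝ := fun i j =>
  if h : i < j then w ⟨(i, j), h⟩ else if h' : j < i then w ⟨(j, i), h'⟩ else 0

/-- Erdős–Rényi law on adjacency functions. -/
def erLaw (n : ℕ) (p : ℝ) : Measure (Fin n → Fin n → ℝ) :=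
  (Measure.pi fun _ : pairIdx n => bern p).map symFun

/-- Uniform distribution on [0,1]. -/
def unif01 : Measure ℝ := volume.restrict (Set.Icc (0 : ℝ) 1)

/-- Symmetric Rademacher distribution. -/
def rademacher : Measure ℝ :=
  (2 : ℝ≥0∞)⁻¹ • Measure.dirac (-1) + (2 : ℝ≥0∞)⁻¹ • Measure.dirac 1

/-- Joint law of (U, G) for f-random graphs with sparsity n^{-γ}. -/
def fGraphLaw (n : ℕ) (f : ℝ → ℝ → ℝ) (γ : ℝ) :
    Measure ((Fin n → ℝ) × (Fin n → Fin n → ℝ)) :=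
  (Measure.pi fun _ : Fin n => unif01).bind fun U =>
    (Measure.pi fun ij : pairIdx n => bern (f (U ij.1.1) (U ij.1.2) / (n : ℝ) ^ γ)).map
      fun w => (U, symFun w)

/-- The (diluted) Hopfield coupling matrix θ·M_n(i,j)·G_n(i,j), M_n = ZᵀZ/N. -/
def hopA (N : ℕ) {n : ℕ} (θ : ℝ) (G : Fin n → Fin n → ℝ) (Z : Fin N × Fin n → ℝ) :
    Matrix (Fin n) (Fin n) ℝ :=
  Matrix.of fun i j => θ * ((N : ℝ)⁻¹ * ∑ k : Fin N, Z (k, i) * Z (k, j)) * G i j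

/-- σ-algebra generated by the coordinates other than i. -/
def exceptSigma (n : ℕ) (i : Fin n) : MeasurableSpace (Fin n → ℝ) :=
  MeasurableSpace.comap (fun σ => Function.update σ i 0) inferInstance

/-- Conditional expectation of g(σ_i) given the other coordinates, under the Gibbs measure. -/
def condB {n : ℕ} (μ : Fin n → Measure ℝ) (A : Matrix (Fin n) (Fin n) ℝ) (c : Fin n → ℝ)
    (g : ℝ → ℝ) (i : Fin n) : (Fin n → ℝ) → ℝ :=
  (gibbs μ A c)[(fun σ => g (σ i)) | exceptSigma n i]

end

/-! ### Stein's equation for a centred Gaussian -/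

lemma integrable_mul_gaussian {k : ℝ → ℝ} (hk : Continuous k) (hk1 : ∀ x, |k x| ≤ 1)
    {b : ℝ} (hb : 0 < b) : Integrable (fun x => k x * Real.exp (-b * x ^ 2)) := by
  refine (integrable_exp_neg_mul_sq hb).bdd_mul (c := 1) hk.aestronglyMeasurable ?_
  exact ae_of_all _ fun x => by simpa using hk1 x

lemma gaussian_tail_le {b w : ℝ} (hb : 0 < b) (hw : 0 ≤ w) :
    ∫ x in Ioi w, Real.exp (-b * x ^ 2) ≤ Real.exp (-b * w ^ 2) * (√(Real.pi / b) / 2) := by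
  have h1 : ∫ x in Ioi w, Real.exp (-b * x ^ 2)
      = ∫ x in Ioi (0 : ℝ), Real.exp (-b * (x + w) ^ 2) := by
    have := (measurePreserving_add_right volume w).setIntegral_preimage_emb
      (measurableEmbedding_addRight w) (fun x => Real.exp (-b * x ^ 2)) (Ioi w)
    rw [← this]
    congr 2
    ext x; simp
  rw [h1, ← integral_gaussian_Ioi, ← integral_const_mul]
  refine setIntegral_mono_on ?_ ?_ measurableSet_Ioi ?_
  · exact ((integrable_exp_neg_mul_sq hb).comp_add_right w).integrableOn
  · exact ((integrable_exp_neg_mul_sq hb).const_mul _).integrableOn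
  · intro x hx
    rw [← Real.exp_add]
    apply Real.exp_le_exp.2
    have : 0 ≤ b * (x * w) := mul_nonneg hb.le (mul_nonneg (le_of_lt hx) hw)
    nlinarith

lemma mul_gaussian_tail_le {b w : ℝ} (hb : 0 < b) :
    w * ∫ x in Ioi w, Real.exp (-b * x ^ 2) ≤ Real.exp (-b * w ^ 2) / (2 * b) := by
  have h1 : ∫ x in Ioi w, x * Real.exp (-b * x ^ 2) = Real.exp (-b * w ^ 2) / (2 * b) := by
    have := integral_Ioi_of_hasDerivAt_of_tendsto
      (f := fun x => -(Real.exp (-b * x ^ 2) / (2 * b)))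
      (f' := fun x => x * Real.exp (-b * x ^ 2)) (a := w) (m := 0) ?_ ?_ ?_ ?_
    · rw [this]; ring
    · exact (by fun_prop : Continuous _).continuousWithinAt
    · intro x _
      have h : HasDerivAt (fun x : ℝ => -(Real.exp (-b * x ^ 2) / (2 * b)))
          (-(Real.exp (-b * x ^ 2) * (-b * (2 * x)) / (2 * b))) x := by
        have := ((hasDerivAt_pow 2 x).const_mul (-b)).exp.div_const (2 * b)
        exact (by simpa using this : HasDerivAt _ _ x).fun_neg
      refine h.congr_deriv ?_
      field_simp
    · exact (integrable_mul_exp_neg_mul_sq hb).integrableOn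
    · have h0 : Tendsto (fun x : ℝ => Real.exp (-b * x ^ 2)) atTop (𝓝 0) := by
        apply Real.tendsto_exp_atBot.comp
        exact (tendsto_pow_atTop two_ne_zero).const_mul_atTop_of_neg (by linarith)
      simpa using (h0.div_const (2 * b)).neg
  rw [← h1, ← integral_const_mul]
  refine setIntegral_mono_on ((integrable_exp_neg_mul_sq hb).const_mul _).integrableOn
    (integrable_mul_exp_neg_mul_sq hb).integrableOn measurableSet_Ioi ?_
  intro x hx
  exact mul_le_mul_of_nonneg_right (le_of_lt hx) (Real.exp_pos _).le

/-- A function with mean zero against a Gaussian weight has a well controlled primitive. -/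
lemma abs_gaussian_primitive_le {k : ℝ → ℝ} (hk : Continuous k) (hk1 : ∀ x, |k x| ≤ 1)
    {b : ℝ} (hb : 0 < b) (h0 : ∫ x, k x * Real.exp (-b * x ^ 2) = 0) (w : ℝ) :
    |∫ x in Iic w, k x * Real.exp (-b * x ^ 2)|
      ≤ ∫ x in Ioi |w|, Real.exp (-b * x ^ 2) := by
  have hi := integrable_mul_gaussian hk hk1 hb
  have hg := integrable_exp_neg_mul_sq hb
  have key : ∀ s : Set ℝ, MeasurableSet s → |∫ x in s, k x * Real.exp (-b * x ^ 2)|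
      ≤ ∫ x in s, Real.exp (-b * x ^ 2) := by
    intro s _
    rw [← Real.norm_eq_abs]
    refine norm_integral_le_of_norm_le hg.integrableOn (ae_of_all _ fun x => ?_)
    rw [norm_mul, Real.norm_eq_abs, Real.norm_eq_abs, Real.abs_exp]
    exact mul_le_of_le_one_left (Real.exp_pos _).le (hk1 x)
  rcases le_total 0 w with hw | hw
  · have := integral_add_compl (s := Iic w) measurableSet_Iic hi
    rw [h0, compl_Iic] at this
    rw [abs_of_nonneg hw, eq_neg_of_add_eq_zero_left this, abs_neg]
    exact key _ measurableSet_Ioi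
  · rw [abs_of_nonpos hw, ← integral_comp_neg_Iic]
    simpa using key _ measurableSet_Iic

/-- Solution of Stein's equation for `N(0, v)`. -/
theorem exists_stein_solution {v : ℝ} (hv : 0 < v) {h : ℝ → ℝ} (hc : Continuous h)
    (h01 : ∀ x, 0 ≤ h x ∧ h x ≤ 1) :
    ∃ f f' : ℝ → ℝ, (∀ w, HasDerivAt f (f' w) w) ∧ Continuous f' ∧
      (∀ w, v * f' w - w * f w = h w - ∫ x, h x ∂gaussianReal 0 v.toNNReal) ∧
      (∀ w, |f w| ≤ √(Real.pi * 2 / v) / 2) ∧ (∀ w, |f' w| ≤ 2 / v) := by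
  have hv0 : v.toNNReal ≠ 0 := by simpa using hv
  set N := ∫ x, h x ∂gaussianReal 0 v.toNNReal with hN
  have hint : Integrable h (gaussianReal 0 v.toNNReal) :=
    Integrable.of_bound hc.aestronglyMeasurable 1
      (ae_of_all _ fun x => by rw [Real.norm_eq_abs, abs_of_nonneg (h01 x).1]; exact (h01 x).2)
  have hN0 : 0 ≤ N := integral_nonneg fun x => (h01 x).1
  have hN1 : N ≤ 1 := by
    have := integral_mono hint (integrable_const (1 : ℝ)) fun x => (h01 x).2
    simpa using this
  set b : ℝ := 1 / (2 * v) with hbdef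
  have hb : 0 < b := by positivity
  set k : ℝ → ℝ := fun x => h x - N with hkdef
  have hk : Continuous k := by fun_prop
  have hk1 : ∀ x, |k x| ≤ 1 := fun x => by
    rw [abs_le]; constructor <;> simp only [hkdef] <;> linarith [(h01 x).1, (h01 x).2]
  have hk0 : ∫ x, k x * Real.exp (-b * x ^ 2) = 0 := by
    have h1 : ∫ x, k x ∂gaussianReal 0 v.toNNReal = 0 := by
      rw [integral_sub hint (integrable_const _)]; simp [hN]
    rw [integral_gaussianReal_eq_integral_smul hv0] at h1
    have h2 : ∀ x, gaussianPDFReal 0 v.toNNReal x • k x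
        = (√(2 * Real.pi * v))⁻¹ * (k x * Real.exp (-b * x ^ 2)) := by
      intro x
      simp only [gaussianPDFReal, Real.coe_toNNReal v hv.le, sub_zero, smul_eq_mul, hbdef]
      rw [show -x ^ 2 / (2 * v) = -(1 / (2 * v)) * x ^ 2 by ring]
      ring
    simp_rw [h2] at h1
    rw [integral_const_mul] at h1
    exact (mul_eq_zero.1 h1).resolve_left (by positivity)
  set F : ℝ → ℝ := fun w => ∫ x in Iic w, k x * Real.exp (-b * x ^ 2) with hF
  have hi := integrable_mul_gaussian hk hk1 hb
  have hcont : Continuous fun x => k x * Real.exp (-b * x ^ 2) := by fun_prop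
  have hFd : ∀ w, HasDerivAt F (k w * Real.exp (-b * w ^ 2)) w := by
    intro w
    have h1 : F = fun u => (∫ x in (0 : ℝ)..u, k x * Real.exp (-b * x ^ 2)) + F 0 := by
      ext u
      rw [← intervalIntegral.integral_Iic_sub_Iic hi.integrableOn hi.integrableOn]
      simp [hF]
    rw [h1]
    exact (intervalIntegral.integral_hasDerivAt_right (hcont.intervalIntegrable _ _)
      hcont.stronglyMeasurable.stronglyMeasurableAtFilter hcont.continuousAt).add_const _
  have hFb := abs_gaussian_primitive_le hk hk1 hb hk0
  set f : ℝ → ℝ := fun w => 1 / v * (Real.exp (b * w ^ 2) * F w) with hf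
  have hfd : ∀ w, HasDerivAt f ((w * f w + k w) / v) w := by
    intro w
    have h : HasDerivAt f (1 / v * (Real.exp (b * w ^ 2) * (b * (2 * w)) * F w
        + Real.exp (b * w ^ 2) * (k w * Real.exp (-b * w ^ 2)))) w := by
      have h1 := ((hasDerivAt_pow 2 w).const_mul b).exp
      exact ((by simpa using h1 : HasDerivAt (fun x => Real.exp (b * x ^ 2)) _ w).fun_mul
        (hFd w)).const_mul (1 / v)
    convert h using 1
    have : Real.exp (b * w ^ 2) * Real.exp (-b * w ^ 2) = 1 := by
      rw [← Real.exp_add]; simp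
    simp only [hf]
    have e2 : Real.exp (b * w ^ 2) * (k w * Real.exp (-b * w ^ 2)) = k w := by
      rw [mul_left_comm, this, mul_one]
    rw [e2]
    have : 2 * v * b = 1 := by rw [hbdef]; field_simp
    generalize Real.exp (b * w ^ 2) = G
    field_simp
    linear_combination (-(G * F w * w)) * this
  have hfc : Continuous f := continuous_iff_continuousAt.2 fun w => (hfd w).continuousAt
  have hwf : ∀ w, |w * f w| ≤ 1 := by
    intro w
    have h1 := mul_gaussian_tail_le (w := |w|) hb
    have h2 : |w| * |F w| ≤ Real.exp (-b * w ^ 2) / (2 * b) := by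
      rw [sq_abs] at h1
      exact (mul_le_mul_of_nonneg_left (hFb w) (abs_nonneg w)).trans h1
    rw [hf, abs_mul, abs_mul, abs_mul, Real.abs_exp, abs_of_pos (by positivity : 0 < 1 / v)]
    calc |w| * (1 / v * (Real.exp (b * w ^ 2) * |F w|))
        = 1 / v * Real.exp (b * w ^ 2) * (|w| * |F w|) := by ring
      _ ≤ 1 / v * Real.exp (b * w ^ 2) * (Real.exp (-b * w ^ 2) / (2 * b)) := by gcongr
      _ = 1 / v * (Real.exp (b * w ^ 2) * Real.exp (-b * w ^ 2)) / (2 * b) := by ring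
      _ = 1 := by
        rw [← Real.exp_add, hbdef]; simp; field_simp
  refine ⟨f, fun w => (w * f w + k w) / v, hfd, by fun_prop, fun w => ?_, fun w => ?_, fun w => ?_⟩
  · simp only [hkdef]; field_simp; ring
  · have h1 := gaussian_tail_le hb (abs_nonneg w)
    rw [sq_abs] at h1
    rw [hf, abs_mul, abs_mul, Real.abs_exp, abs_of_pos (by positivity : 0 < 1 / v)]
    calc 1 / v * (Real.exp (b * w ^ 2) * |F w|)
        ≤ 1 / v * (Real.exp (b * w ^ 2) * (Real.exp (-b * w ^ 2) * (√(Real.pi / b) / 2))) := by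
          gcongr; exact (hFb w).trans h1
      _ = 1 / v * (√(Real.pi / b) / 2) := by
          rw [← mul_assoc (Real.exp _), ← Real.exp_add]; simp
      _ = √(Real.pi * 2 / v) / 2 := by
          have : Real.pi / b = v ^ 2 * (Real.pi * 2 / v) := by rw [hbdef]; field_simp
          rw [this, Real.sqrt_mul (by positivity), Real.sqrt_sq hv.le]; field_simp
  · rw [abs_div, abs_of_pos hv]
    gcongr
    exact (abs_add_le _ _).trans (by linarith [hwf w, hk1 w])

/-- Continuous approximation of the indicator of `Iic t`. -/
noncomputable def ramp (t δ w : ℝ) : ℝ := max 0 (min 1 (1 - (w - t) / δ))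

lemma continuous_ramp (t δ : ℝ) : Continuous (ramp t δ) := by
  unfold ramp; fun_prop

lemma ramp_mem (t δ w : ℝ) : 0 ≤ ramp t δ w ∧ ramp t δ w ≤ 1 :=
  ⟨le_max_left _ _, max_le zero_le_one (min_le_left _ _)⟩

lemma ramp_eq_one {t δ w : ℝ} (hδ : 0 < δ) (h : w ≤ t) : ramp t δ w = 1 := by
  have : (w - t) / δ ≤ 0 := div_nonpos_of_nonpos_of_nonneg (by linarith) hδ.le
  rw [ramp, min_eq_left (by linarith), max_eq_right zero_le_one]

lemma ramp_eq_zero {t δ w : ℝ} (hδ : 0 < δ) (h : t + δ ≤ w) : ramp t δ w = 0 := by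
  have : 1 ≤ (w - t) / δ := by rw [le_div_iff₀ hδ]; linarith
  rw [ramp, max_eq_left ((min_le_right _ _).trans (by linarith))]

lemma measureReal_Iic_le_integral_ramp (Q : Measure ℝ) [IsProbabilityMeasure Q] (t : ℝ) {δ : ℝ}
    (hδ : 0 < δ) :
    (Q (Iic t)).toReal ≤ ∫ x, ramp t δ x ∂Q ∧ ∫ x, ramp t δ x ∂Q ≤ (Q (Iic (t + δ))).toReal := by
  have hi : Integrable (ramp t δ) Q :=
    Integrable.of_bound (continuous_ramp t δ).aestronglyMeasurable 1
      (ae_of_all _ fun x => by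
        rw [Real.norm_eq_abs, abs_of_nonneg (ramp_mem t δ x).1]; exact (ramp_mem t δ x).2)
  have e : ∀ s, (Q (Iic s)).toReal = ∫ x, (Iic s).indicator (fun _ => (1 : ℝ)) x ∂Q := by
    intro s
    rw [integral_indicator measurableSet_Iic]; simp [Measure.real]
  have hint : ∀ s, Integrable (fun x => (Iic s).indicator (fun _ => (1 : ℝ)) x) Q := fun s =>
    (integrable_const _).indicator measurableSet_Iic
  rw [e, e]
  refine ⟨integral_mono (hint _) hi fun x => ?_, integral_mono hi (hint _) fun x => ?_⟩
  · by_cases hx : x ≤ t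
    · simp [hx, ramp_eq_one hδ hx]
    · simp [hx, (ramp_mem t δ x).1]
  · by_cases hx : x ≤ t + δ
    · simpa [hx] using (ramp_mem t δ x).2
    · simp [hx, ramp_eq_zero hδ (not_le.1 hx).le]

lemma gaussianReal_Iic_add_le {v : ℝ} (hv : 0 < v) (t : ℝ) {δ : ℝ} (hδ : 0 < δ) :
    (gaussianReal 0 v.toNNReal (Iic (t + δ))).toReal
      ≤ (gaussianReal 0 v.toNNReal (Iic t)).toReal + δ / √(2 * Real.pi * v) := by
  have hv0 : v.toNNReal ≠ 0 := by simpa using hv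
  have e : ∀ s, (gaussianReal 0 v.toNNReal (Iic s)).toReal
      = ∫ x in Iic s, gaussianPDFReal 0 v.toNNReal x := by
    intro s
    rw [gaussianReal_apply_eq_integral _ hv0, ENNReal.toReal_ofReal]
    exact integral_nonneg fun x => gaussianPDFReal_nonneg _ _ _
  have hi := integrable_gaussianPDFReal 0 v.toNNReal
  have h1 := intervalIntegral.integral_Iic_sub_Iic (a := t) (b := t + δ) hi.integrableOn
    hi.integrableOn
  have h2 : ‖∫ x in t..(t + δ), gaussianPDFReal 0 v.toNNReal x‖
      ≤ (√(2 * Real.pi * v))⁻¹ * |t + δ - t| := by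
    refine intervalIntegral.norm_integral_le_of_norm_le_const fun x _ => ?_
    rw [Real.norm_eq_abs, abs_of_nonneg (gaussianPDFReal_nonneg _ _ _), gaussianPDFReal,
      Real.coe_toNNReal v hv.le]
    refine mul_le_of_le_one_right (by positivity) (Real.exp_le_one_iff.2 ?_)
    exact div_nonpos_of_nonpos_of_nonneg (neg_nonpos.2 (sq_nonneg _)) (by positivity)
  rw [add_sub_cancel_left, abs_of_pos hδ, Real.norm_eq_abs] at h2
  rw [e, e, div_eq_inv_mul]
  linarith [le_abs_self (∫ x in t..(t + δ), gaussianPDFReal 0 v.toNNReal x)]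

/-- Comparison on smoothed indicators controls the Kolmogorov distance to a Gaussian. -/
theorem dKS_le_of_ramp (Q : Measure ℝ) [IsProbabilityMeasure Q] {v δ E : ℝ} (hv : 0 < v)
    (hδ : 0 < δ) (h : ∀ t, |∫ x, ramp t δ x ∂Q - ∫ x, ramp t δ x ∂gaussianReal 0 v.toNNReal| ≤ E) :
    dKS Q (gaussianReal 0 v.toNNReal) ≤ E + δ / √(2 * Real.pi * v) := by
  refine ciSup_le fun t => ?_
  have a1 := measureReal_Iic_le_integral_ramp Q t hδ
  have a2 := measureReal_Iic_le_integral_ramp Q (t - δ) hδ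
  have b1 := measureReal_Iic_le_integral_ramp (gaussianReal 0 v.toNNReal) t hδ
  have b2 := measureReal_Iic_le_integral_ramp (gaussianReal 0 v.toNNReal) (t - δ) hδ
  have c1 := gaussianReal_Iic_add_le hv t hδ
  have c2 := gaussianReal_Iic_add_le hv (t - δ) hδ
  rw [sub_add_cancel] at a2 b2 c2
  have d1 := abs_le.1 (h t)
  have d2 := abs_le.1 (h (t - δ))
  rw [abs_le]
  constructor <;> linarith [d1.1, d1.2, d2.1, d2.2, a1.1, a1.2, a2.1, a2.2, b1.1, b1.2, b2.1, b2.2]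

/-! ### Weakly dependent spin systems -/

/-- A law `P` on the cube for which `σ i` has conditional mean `p i (h i)` and conditional variance
`p' i (h i)` given the other coordinates, where `h = A σ + c` is the local field, with an
interaction matrix `A` contracting in `ℓ²` and `ℓ⁴`. -/
structure SpinSystem {n : ℕ} (A : Matrix (Fin n) (Fin n) ℝ) (c : Fin n → ℝ) (p p' : Fin n → ℝ → ℝ)
    (ρ al : ℝ) (P : Measure (Fin n → ℝ)) : Prop where
  prob : IsProbabilityMeasure P
  cube : ∀ᵐ σ ∂P, ∀ i, |σ i| ≤ 1
  hasDeriv : ∀ i x, HasDerivAt (p i) (p' i x) x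
  p_le : ∀ i x, |p i x| ≤ 1
  p'_nonneg : ∀ i x, 0 ≤ p' i x
  p'_le : ∀ i x, p' i x ≤ 1
  lip : ∀ i x y, |p' i x - p' i y| ≤ 4 * |x - y|
  mean : ∀ i (g : (Fin n → ℝ) → ℝ), Continuous g → (∀ σ x, g (Function.update σ i x) = g σ) →
    ∫ σ, (σ i - p i (A.mulVec σ i + c i)) * g σ ∂P = 0
  var : ∀ i (g : (Fin n → ℝ) → ℝ), Continuous g → (∀ σ x, g (Function.update σ i x) = g σ) →
    ∫ σ, ((σ i - p i (A.mulVec σ i + c i)) ^ 2 - p' i (A.mulVec σ i + c i)) * g σ ∂P = 0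
  symm : ∀ i j, A i j = A j i
  diag : ∀ i, A i i = 0
  rho_pos : 0 < ρ
  rho_lt : ρ < 1
  l2 : ∀ v : Fin n → ℝ, ∑ i, A.mulVec v i ^ 2 ≤ ρ ^ 2 * ∑ i, v i ^ 2
  l4 : ∀ v : Fin n → ℝ, ∑ i, A.mulVec v i ^ 4 ≤ ρ ^ 4 * ∑ i, v i ^ 4
  row : ∀ i, ∑ j, A i j ^ 2 ≤ al
  al_nonneg : 0 ≤ al
  al_le : al ≤ 1

/-- Weighted sum of the spins centred at their conditional means. -/
def condSum {n : ℕ} (A : Matrix (Fin n) (Fin n) ℝ) (c : Fin n → ℝ) (p : Fin n → ℝ → ℝ)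
    (a σ : Fin n → ℝ) : ℝ := ∑ j, a j * (σ j - p j (A.mulVec σ j + c j))

/-- Bound for the influence of the `j`-th spin on `condSum`. -/
def influence {n : ℕ} (A : Matrix (Fin n) (Fin n) ℝ) (c : Fin n → ℝ) (p' : Fin n → ℝ → ℝ)
    (a σ : Fin n → ℝ) (j : Fin n) : ℝ :=
  |a j| + |A.mulVec (fun k => p' k (A.mulVec σ k + c k) * a k) j| + 4 * ∑ k, |a k| * A j k ^ 2

/-- The `ℓ⁴`-norm squared of the field `A σ`. -/
noncomputable def fieldNorm {n : ℕ} (A : Matrix (Fin n) (Fin n) ℝ) (σ : Fin n → ℝ) : ℝ :=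
  √(∑ i, A.mulVec σ i ^ 4)

lemma abs_sub_sub_mul_le_of_lipschitz_deriv {f f' : ℝ → ℝ} {L : ℝ}
    (hd : ∀ x, HasDerivAt f (f' x) x) (hL : ∀ x y, |f' x - f' y| ≤ L * |x - y|) (x y : ℝ) :
    |f x - f y - f' y * (x - y)| ≤ L * (x - y) ^ 2 := by
  have hL0 : 0 ≤ L := by
    have := (abs_nonneg _).trans (hL 1 0)
    simpa using this
  have h := Convex.norm_image_sub_le_of_norm_hasDerivWithin_le (𝕜 := ℝ)
    (f := fun z => f z - f' y * z) (f' := fun z => f' z - f' y) (s := uIcc y x)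
    (C := L * |x - y|) (x := y) (y := x)
    (fun z _ => (((hd z).sub ((hasDerivAt_id z).const_mul (f' y))).congr_deriv
      (by simp)).hasDerivWithinAt)
    (fun z hz => (hL z y).trans (mul_le_mul_of_nonneg_left
      (abs_sub_left_of_mem_uIcc hz) hL0))
    (convex_uIcc y x) left_mem_uIcc right_mem_uIcc
  rw [Real.norm_eq_abs, Real.norm_eq_abs, mul_assoc, abs_mul_abs_self] at h
  calc _ = |f x - f' y * x - (f y - f' y * y)| := by congr 1; ring
    _ ≤ _ := by rw [pow_two]; exact h

lemma sq_sum_mul_le {n : ℕ} (a b : Fin n → ℝ) :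
    |∑ i, a i * b i| ≤ √(∑ i, a i ^ 2) * √(∑ i, b i ^ 2) := by
  rw [← Real.sqrt_mul (Finset.sum_nonneg fun i _ => sq_nonneg _)]
  exact Real.abs_le_sqrt (Finset.sum_mul_sq_le_sq_mul_sq _ _ _)

lemma sum_abs_mul_sq_le {n : ℕ} (a m : Fin n → ℝ) :
    ∑ i, |a i| * m i ^ 2 ≤ √(∑ i, a i ^ 2) * √(∑ i, m i ^ 4) := by
  have h := sq_sum_mul_le (fun i => |a i|) (fun i => m i ^ 2)
  simp only [sq_abs, ← pow_mul] at h
  exact (le_abs_self _).trans h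

lemma abs_integral_mul_le {α : Type*} [MeasurableSpace α] {P : Measure α} {X G : α → ℝ} {B : ℝ}
    (hX : Integrable X P) (hG : ∀ x, |G x| ≤ B) :
    |∫ x, X x * G x ∂P| ≤ B * ∫ x, |X x| ∂P := by
  rw [← integral_const_mul, ← Real.norm_eq_abs]
  refine norm_integral_le_of_norm_le (hX.abs.const_mul B) (ae_of_all _ fun x => ?_)
  rw [Real.norm_eq_abs, abs_mul, mul_comm]
  exact mul_le_mul_of_nonneg_right (hG x) (abs_nonneg _)

lemma integral_abs_le_sqrt {α : Type*} [MeasurableSpace α] {P : Measure α} [IsProbabilityMeasure P]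
    {X : α → ℝ} (hX : Integrable X P) (hX2 : Integrable (fun x => X x ^ 2) P) :
    ∫ x, |X x| ∂P ≤ √(∫ x, X x ^ 2 ∂P) := by
  apply Real.le_sqrt_of_sq_le
  set m := ∫ x, |X x| ∂P with hm
  have h : 0 ≤ ∫ x, (|X x| - m) ^ 2 ∂P := integral_nonneg fun x => sq_nonneg _
  have e : ∀ x, (|X x| - m) ^ 2 = X x ^ 2 - 2 * m * |X x| + m ^ 2 := fun x => by
    rw [← sq_abs (X x)]; ring
  simp_rw [e] at h
  rw [integral_add (f := fun x => X x ^ 2 - 2 * m * |X x|) (hX2.sub (hX.abs.const_mul _))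
    (integrable_const _), integral_sub hX2 (hX.abs.const_mul _), integral_const_mul, ← hm] at h
  simp at h
  nlinarith

lemma integrable_of_ae_abs_le_one {ι : Type*} [Fintype ι] {P : Measure (ι → ℝ)}
    [IsFiniteMeasure P] (hP : ∀ᵐ σ ∂P, ∀ i, |σ i| ≤ 1) {F : (ι → ℝ) → ℝ} (hF : Continuous F) :
    Integrable F P := by
  have hK : IsCompact (Set.pi univ fun _ : ι => Icc (-1 : ℝ) 1) :=
    isCompact_univ_pi fun _ => isCompact_Icc
  have h := (hF.continuousOn (s := Set.pi univ fun _ : ι => Icc (-1 : ℝ) 1)).integrableOn_compact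
    (μ := P) hK
  rwa [IntegrableOn, Measure.restrict_eq_self_of_ae_mem] at h
  filter_upwards [hP] with σ hσ
  exact fun i _ => abs_le.1 (hσ i)

namespace SpinSystem

variable {n : ℕ} {A : Matrix (Fin n) (Fin n) ℝ} {c : Fin n → ℝ} {p p' : Fin n → ℝ → ℝ}
  {ρ al : ℝ} {P : Measure (Fin n → ℝ)}

lemma integrable (S : SpinSystem A c p p' ρ al P) {F : (Fin n → ℝ) → ℝ} (hF : Continuous F) :
    Integrable F P :=
  have := S.prob
  integrable_of_ae_abs_le_one S.cube hF

lemma continuous_p (S : SpinSystem A c p p' ρ al P) (i : Fin n) : Continuous (p i) :=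
  continuous_iff_continuousAt.2 fun x => (S.hasDeriv i x).continuousAt

lemma continuous_p' (S : SpinSystem A c p p' ρ al P) (i : Fin n) : Continuous (p' i) :=
  (LipschitzWith.of_dist_le_mul (K := 4) fun x y => by
    simpa [Real.dist_eq] using S.lip i x y).continuous

lemma continuous_field (i : Fin n) : Continuous fun σ : Fin n → ℝ => A.mulVec σ i := by
  unfold Matrix.mulVec dotProduct; fun_prop

lemma continuous_mean (S : SpinSystem A c p p' ρ al P) (i : Fin n) :
    Continuous fun σ : Fin n → ℝ => p i (A.mulVec σ i + c i) :=
  (S.continuous_p i).comp ((continuous_field i).add continuous_const)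

lemma continuous_condSum (S : SpinSystem A c p p' ρ al P) (a : Fin n → ℝ) :
    Continuous (condSum A c p a) := by
  have := S.continuous_p
  have hf := continuous_field (A := A)
  unfold condSum; fun_prop

lemma continuous_fieldNorm : Continuous (fieldNorm A) := by
  have := continuous_field (A := A)
  unfold fieldNorm; fun_prop

lemma field_update (σ : Fin n → ℝ) (j : Fin n) (x : ℝ) (i : Fin n) :
    A.mulVec (Function.update σ j x) i = A.mulVec σ i + A i j * (x - σ j) := by
  have : Function.update σ j x = σ + Pi.single j (x - σ j) := by
    ext k
    by_cases h : k = j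
    · subst h; simp
    · simp [h]
  rw [this, Matrix.mulVec_add, Matrix.mulVec_single]
  simp

lemma field_update_self (S : SpinSystem A c p p' ρ al P) (σ : Fin n → ℝ) (j : Fin n) (x : ℝ) :
    A.mulVec (Function.update σ j x) j = A.mulVec σ j := by
  rw [field_update, S.diag]; simp

lemma abs_sub_mean_le (S : SpinSystem A c p p' ρ al P) {σ : Fin n → ℝ} (hσ : ∀ i, |σ i| ≤ 1)
    (j : Fin n) (x : ℝ) : |σ j - p j x| ≤ 2 :=
  (abs_sub _ _).trans (by linarith [hσ j, S.p_le j x])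

lemma abs_p_sub_le (S : SpinSystem A c p p' ρ al P) (j : Fin n) (x y : ℝ) :
    |p j x - p j y| ≤ |x - y| := by
  have := Convex.norm_image_sub_le_of_norm_hasDerivWithin_le (𝕜 := ℝ) (s := univ) (C := 1)
    (fun z _ => (S.hasDeriv j z).hasDerivWithinAt)
    (fun z _ => by rw [Real.norm_eq_abs, abs_of_nonneg (S.p'_nonneg j z)]; exact S.p'_le j z)
    convex_univ (mem_univ y) (mem_univ x)
  simpa using this

lemma taylor (S : SpinSystem A c p p' ρ al P) (j : Fin n) (x y : ℝ) :
    |p j x - p j y - p' j y * (x - y)| ≤ 4 * (x - y) ^ 2 :=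
  abs_sub_sub_mul_le_of_lipschitz_deriv (S.hasDeriv j) (S.lip j) x y

/-- Integration by parts against `condSum`. -/
lemma integral_condSum_mul (S : SpinSystem A c p p' ρ al P) (a : Fin n → ℝ)
    {G : (Fin n → ℝ) → ℝ} (hG : Continuous G) {G' : Fin n → (Fin n → ℝ) → ℝ}
    (hG' : ∀ j, Continuous (G' j)) (hi : ∀ j σ x, G' j (Function.update σ j x) = G' j σ) :
    ∫ σ, condSum A c p a σ * G σ ∂P
      = ∫ σ, ∑ j, a j * ((σ j - p j (A.mulVec σ j + c j)) * (G σ - G' j σ)) ∂P := by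
  have hp := S.continuous_p
  have hf := continuous_field (A := A)
  have h1 : ∀ σ, ∑ j, a j * ((σ j - p j (A.mulVec σ j + c j)) * (G σ - G' j σ))
      = condSum A c p a σ * G σ
        - ∑ j, a j * ((σ j - p j (A.mulVec σ j + c j)) * G' j σ) := by
    intro σ
    rw [condSum, Finset.sum_mul, ← Finset.sum_sub_distrib]
    exact Finset.sum_congr rfl fun j _ => by ring
  simp_rw [h1]
  have hc := S.continuous_condSum a
  rw [integral_sub (S.integrable (by fun_prop)) (S.integrable (by fun_prop)),
    integral_finsetSum _ fun j _ => S.integrable (by fun_prop)]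
  simp_rw [integral_const_mul, S.mean _ _ (hG' _) (hi _)]
  simp

lemma abs_condSum_sub_le (S : SpinSystem A c p p' ρ al P) (a : Fin n → ℝ) {σ : Fin n → ℝ}
    (hσ : ∀ i, |σ i| ≤ 1) (j : Fin n) :
    |condSum A c p a σ - condSum A c p a (Function.update σ j 0)| ≤ influence A c p' a σ j := by
  set τ := Function.update σ j 0 with hτ
  have hf : ∀ k, A.mulVec τ k + c k - (A.mulVec σ k + c k) = -(A k j * σ j) := fun k => by
    rw [hτ, field_update]; ring
  set E : Fin n → ℝ := fun k => p k (A.mulVec τ k + c k) - p k (A.mulVec σ k + c k)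
    - p' k (A.mulVec σ k + c k) * -(A k j * σ j) with hE
  have hEb : ∀ k, |E k| ≤ 4 * A j k ^ 2 := by
    intro k
    have := S.taylor k (A.mulVec τ k + c k) (A.mulVec σ k + c k)
    rw [hf] at this
    refine this.trans ?_
    rw [S.symm k j, neg_sq, mul_pow]
    have : σ j ^ 2 ≤ 1 := (sq_le_one_iff_abs_le_one _).2 (hσ j)
    nlinarith [sq_nonneg (A j k)]
  have key : condSum A c p a σ - condSum A c p a τ
      = a j * σ j - σ j * A.mulVec (fun k => p' k (A.mulVec σ k + c k) * a k) j
        + ∑ k, a k * E k := by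
    have h1 : a j * σ j = ∑ k, a k * (σ k - τ k) := by
      rw [Finset.sum_eq_single j]
      · simp [hτ]
      · intro k _ hk; simp [hτ, hk]
      · simp
    rw [h1]
    simp only [condSum, Matrix.mulVec, dotProduct, Finset.mul_sum]
    rw [← Finset.sum_sub_distrib, ← Finset.sum_sub_distrib, ← Finset.sum_add_distrib]
    refine Finset.sum_congr rfl fun k _ => ?_
    simp only [hE, Matrix.mulVec, dotProduct]
    rw [S.symm j k]
    ring
  rw [key, influence]
  refine (abs_add_le _ _).trans (add_le_add ((abs_sub _ _).trans (add_le_add ?_ ?_)) ?_)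
  · rw [abs_mul]; exact mul_le_of_le_one_right (abs_nonneg _) (hσ j)
  · rw [abs_mul]; exact mul_le_of_le_one_left (abs_nonneg _) (hσ j)
  · refine (Finset.abs_sum_le_sum_abs _ _).trans ?_
    rw [Finset.mul_sum]
    refine Finset.sum_le_sum fun k _ => ?_
    rw [abs_mul]
    calc |a k| * |E k| ≤ |a k| * (4 * A j k ^ 2) := by gcongr; exact hEb k
      _ = _ := by ring

lemma influence_nonneg (a σ : Fin n → ℝ) (j : Fin n) : 0 ≤ influence A c p' a σ j := by
  unfold influence; positivity

lemma sum_influence_sq_le (S : SpinSystem A c p p' ρ al P) (a σ : Fin n → ℝ) :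
    ∑ j, influence A c p' a σ j ^ 2 ≤ 54 * ∑ j, a j ^ 2 := by
  have hs : 0 ≤ ∑ j, a j ^ 2 := Finset.sum_nonneg fun j _ => sq_nonneg _
  have h2 : ∑ j, A.mulVec (fun k => p' k (A.mulVec σ k + c k) * a k) j ^ 2 ≤ ∑ j, a j ^ 2 := by
    refine (S.l2 _).trans ?_
    have : ∑ k, (p' k (A.mulVec σ k + c k) * a k) ^ 2 ≤ ∑ j, a j ^ 2 := by
      refine Finset.sum_le_sum fun k _ => ?_
      rw [mul_pow]
      exact mul_le_of_le_one_left (sq_nonneg _) (pow_le_one₀ (S.p'_nonneg _ _) (S.p'_le _ _))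
    have hr : ρ ^ 2 ≤ 1 := pow_le_one₀ S.rho_pos.le S.rho_lt.le
    nlinarith
  have h3 : ∑ j, (∑ k, |a k| * A j k ^ 2) ^ 2 ≤ ∑ j, a j ^ 2 := by
    have h4 : ∀ j, (∑ k, |a k| * A j k ^ 2) ^ 2 ≤ ∑ k, a k ^ 2 * A j k ^ 2 := by
      intro j
      have := Finset.sum_mul_sq_le_sq_mul_sq Finset.univ (fun k => |a k| * A j k) (fun k => A j k)
      calc (∑ k, |a k| * A j k ^ 2) ^ 2 = (∑ k, |a k| * A j k * A j k) ^ 2 := by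
            congr 1; exact Finset.sum_congr rfl fun k _ => by ring
        _ ≤ (∑ k, (|a k| * A j k) ^ 2) * ∑ k, A j k ^ 2 := this
        _ ≤ (∑ k, (|a k| * A j k) ^ 2) * 1 := by
            gcongr
            exact (S.row j).trans S.al_le
        _ = _ := by simp [mul_pow]
    calc _ ≤ ∑ j, ∑ k, a k ^ 2 * A j k ^ 2 := Finset.sum_le_sum fun j _ => h4 j
      _ = ∑ k, a k ^ 2 * ∑ j, A k j ^ 2 := by
          rw [Finset.sum_comm]
          refine Finset.sum_congr rfl fun k _ => ?_
          rw [Finset.mul_sum]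
          exact Finset.sum_congr rfl fun j _ => by rw [S.symm]
      _ ≤ ∑ k, a k ^ 2 := Finset.sum_le_sum fun k _ =>
          mul_le_of_le_one_right (sq_nonneg _) ((S.row k).trans S.al_le)
  calc ∑ j, influence A c p' a σ j ^ 2
      ≤ ∑ j, (3 * a j ^ 2 + 3 * A.mulVec (fun k => p' k (A.mulVec σ k + c k) * a k) j ^ 2
        + 48 * (∑ k, |a k| * A j k ^ 2) ^ 2) := by
        refine Finset.sum_le_sum fun j _ => ?_
        unfold influence
        rw [← sq_abs (a j), ← sq_abs (A.mulVec _ j)]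
        generalize |a j| = x
        generalize |A.mulVec _ j| = y
        generalize ∑ k, |a k| * A j k ^ 2 = z
        nlinarith [sq_nonneg (x - y), sq_nonneg (x - 4 * z), sq_nonneg (y - 4 * z)]
    _ ≤ _ := by
        rw [Finset.sum_add_distrib, Finset.sum_add_distrib, ← Finset.mul_sum, ← Finset.mul_sum,
          ← Finset.mul_sum]
        linarith

lemma sum_abs_mul_influence_le (S : SpinSystem A c p p' ρ al P) (a σ : Fin n → ℝ) :
    ∑ j, 2 * (|a j| * influence A c p' a σ j) ≤ 55 * ∑ j, a j ^ 2 := by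
  calc ∑ j, 2 * (|a j| * influence A c p' a σ j)
      ≤ ∑ j, (a j ^ 2 + influence A c p' a σ j ^ 2) := Finset.sum_le_sum fun j _ => by
        rw [← sq_abs (a j)]; nlinarith [sq_nonneg (|a j| - influence A c p' a σ j)]
    _ ≤ _ := by rw [Finset.sum_add_distrib]; linarith [S.sum_influence_sq_le a σ]

lemma condSum_update_update (a σ : Fin n → ℝ) (j : Fin n) (x : ℝ) :
    condSum A c p a (Function.update (Function.update σ j x) j 0)
      = condSum A c p a (Function.update σ j 0) := by
  rw [Function.update_idem]

lemma continuous_condSum_update (S : SpinSystem A c p p' ρ al P) (a : Fin n → ℝ) (j : Fin n) :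
    Continuous fun σ => condSum A c p a (Function.update σ j 0) :=
  (S.continuous_condSum a).comp (continuous_id.update j continuous_const)

theorem integral_condSum_sq_le (S : SpinSystem A c p p' ρ al P) (a : Fin n → ℝ) :
    ∫ σ, condSum A c p a σ ^ 2 ∂P ≤ 55 * ∑ j, a j ^ 2 := by
  have := S.prob
  simp_rw [pow_two (condSum A c p a _)]
  rw [S.integral_condSum_mul a (S.continuous_condSum a) (S.continuous_condSum_update a)
    fun j σ x => condSum_update_update a σ j x]
  refine (le_abs_self _).trans ?_
  have h : ∀ᵐ σ ∂P, ‖∑ j, a j * ((σ j - p j (A.mulVec σ j + c j)) *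
      (condSum A c p a σ - condSum A c p a (Function.update σ j 0)))‖ ≤ 55 * ∑ j, a j ^ 2 := by
    filter_upwards [S.cube] with σ hσ
    refine le_trans ?_ (S.sum_abs_mul_influence_le a σ)
    refine (norm_sum_le _ _).trans (Finset.sum_le_sum fun j _ => ?_)
    rw [Real.norm_eq_abs, abs_mul, abs_mul]
    calc |a j| * (|σ j - p j (A.mulVec σ j + c j)| *
          |condSum A c p a σ - condSum A c p a (Function.update σ j 0)|)
        ≤ |a j| * (2 * influence A c p' a σ j) := by
          gcongr
          · exact S.abs_sub_mean_le hσ j _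
          · exact S.abs_condSum_sub_le a hσ j
      _ = _ := by ring
  simpa using norm_integral_le_of_norm_le_const h

theorem integral_abs_condSum_le (S : SpinSystem A c p p' ρ al P) (a : Fin n → ℝ) :
    ∫ σ, |condSum A c p a σ| ∂P ≤ 8 * √(∑ j, a j ^ 2) := by
  have := S.prob
  have hc := S.continuous_condSum a
  refine (integral_abs_le_sqrt (S.integrable hc) (S.integrable (by fun_prop))).trans ?_
  refine (Real.sqrt_le_sqrt ((S.integral_condSum_sq_le a).trans (mul_le_mul_of_nonneg_right
    (by norm_num : (55 : ℝ) ≤ 8 ^ 2) (Finset.sum_nonneg fun j _ => sq_nonneg _)))).trans ?_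
  rw [Real.sqrt_mul (by positivity), Real.sqrt_sq (by norm_num)]

lemma abs_cube_sub_cube_le {x y d : ℝ} (h : |x - y| ≤ d) :
    |x ^ 3 - y ^ 3| ≤ 5 * x ^ 2 * d + 3 * d ^ 3 := by
  have hd : 0 ≤ d := (abs_nonneg _).trans h
  have h2 : (x - y) ^ 2 ≤ d ^ 2 := by rw [← sq_abs]; gcongr
  have e : x ^ 3 - y ^ 3 = (x - y) * (x ^ 2 + x * y + y ^ 2) := by ring
  have q0 : 0 ≤ x ^ 2 + x * y + y ^ 2 := by nlinarith [sq_nonneg (x + y), sq_nonneg x, sq_nonneg y]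
  have q1 : x ^ 2 + x * y + y ^ 2 ≤ 5 * x ^ 2 + 3 * d ^ 2 := by
    nlinarith [sq_nonneg (x + (x - y)), sq_nonneg x]
  rw [e, abs_mul, abs_of_nonneg q0]
  calc |x - y| * (x ^ 2 + x * y + y ^ 2) ≤ d * (5 * x ^ 2 + 3 * d ^ 2) := by gcongr
    _ = _ := by ring

theorem integral_condSum_pow_four_le (S : SpinSystem A c p p' ρ al P) (a : Fin n → ℝ) :
    ∫ σ, condSum A c p a σ ^ 4 ∂P ≤ 24035 * (∑ j, a j ^ 2) ^ 2 := by
  have := S.prob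
  set s := ∑ j, a j ^ 2 with hs
  have hs0 : 0 ≤ s := Finset.sum_nonneg fun j _ => sq_nonneg _
  have hc := S.continuous_condSum a
  have hcu := S.continuous_condSum_update a
  have e : ∀ σ, condSum A c p a σ ^ 4 = condSum A c p a σ * condSum A c p a σ ^ 3 :=
    fun σ => by ring
  simp_rw [e]
  rw [S.integral_condSum_mul a (G := fun σ => condSum A c p a σ ^ 3) (hc.pow 3)
    (G' := fun j σ => condSum A c p a (Function.update σ j 0) ^ 3) (fun j => (hcu j).pow 3)
    fun j σ x => by rw [condSum_update_update a σ j x]]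
  have hp := S.continuous_p
  have hf := continuous_field (A := A)
  have h : ∀ᵐ σ ∂P, ∑ j, a j * ((σ j - p j (A.mulVec σ j + c j)) *
      (condSum A c p a σ ^ 3 - condSum A c p a (Function.update σ j 0) ^ 3))
        ≤ 275 * s * condSum A c p a σ ^ 2 + 8910 * s ^ 2 := by
    filter_upwards [S.cube] with σ hσ
    have hI : ∀ j, influence A c p' a σ j ^ 2 ≤ 54 * s := fun j =>
      (Finset.single_le_sum (f := fun j => influence A c p' a σ j ^ 2)
        (fun j _ => sq_nonneg _) (Finset.mem_univ j)).trans (S.sum_influence_sq_le a σ)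
    calc _ ≤ ∑ j, (2 * (|a j| * influence A c p' a σ j)) *
          (5 * condSum A c p a σ ^ 2 + 162 * s) := by
          refine Finset.sum_le_sum fun j _ => (le_abs_self _).trans ?_
          rw [abs_mul, abs_mul]
          have h0 := influence_nonneg (A := A) (c := c) (p' := p') a σ j
          calc _ ≤ |a j| * (2 * (5 * condSum A c p a σ ^ 2 * influence A c p' a σ j
                + 3 * influence A c p' a σ j ^ 3)) := by
                gcongr
                · exact S.abs_sub_mean_le hσ j _
                · exact abs_cube_sub_cube_le (S.abs_condSum_sub_le a hσ j)
            _ = (2 * (|a j| * influence A c p' a σ j)) *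
                (5 * condSum A c p a σ ^ 2 + 3 * influence A c p' a σ j ^ 2) := by ring
            _ ≤ _ := mul_le_mul_of_nonneg_left (by linarith [hI j]) (by positivity)
      _ ≤ 55 * s * (5 * condSum A c p a σ ^ 2 + 162 * s) := by
          rw [← Finset.sum_mul]
          gcongr
          exact S.sum_abs_mul_influence_le a σ
      _ = _ := by ring
  have h2 := integral_mono_ae (S.integrable (by fun_prop)) (S.integrable (by fun_prop)) h
  refine h2.trans ?_
  rw [integral_add (S.integrable (by fun_prop)) (integrable_const _), integral_const_mul]
  have h3 := S.integral_condSum_sq_le a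
  simp only [integral_const, probReal_univ, smul_eq_mul, one_mul]
  nlinarith

lemma add_pow_four_le {t : ℝ} (h0 : 0 < t) (h1 : t < 1) (x y : ℝ) :
    (x + y) ^ 4 ≤ x ^ 4 / t ^ 3 + y ^ 4 / (1 - t) ^ 3 := by
  have h := (even_two_mul 2).convexOn_pow.2 (mem_univ (x / t)) (mem_univ (y / (1 - t))) h0.le
    (sub_nonneg.2 h1.le) (by ring : t + (1 - t) = 1)
  have h2 : (1 - t) ≠ 0 := by linarith
  simp only [smul_eq_mul] at h
  norm_num at h
  rw [mul_div_cancel₀ _ h0.ne', mul_div_cancel₀ _ h2] at h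
  refine h.trans (le_of_eq ?_)
  field_simp

/-- Self-consistent bound for the `ℓ⁴`-norm of the field. -/
lemma sum_field_pow_four_le (S : SpinSystem A c p p' ρ al P) (σ : Fin n → ℝ) :
    ∑ i, A.mulVec σ i ^ 4 ≤ 8 / (1 - ρ) ^ 4 * (∑ i, condSum A c p (A i) σ ^ 4
      + ∑ i, A.mulVec (fun j => p j (c j)) i ^ 4) := by
  have h1 : 0 < 1 - ρ := by linarith [S.rho_lt]
  set w : Fin n → ℝ := fun j => p j (A.mulVec σ j + c j) - p j (c j) with hw
  have hdec : ∀ i, A.mulVec σ i = A.mulVec w i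
      + (condSum A c p (A i) σ + A.mulVec (fun j => p j (c j)) i) := by
    intro i
    simp only [condSum, Matrix.mulVec, dotProduct]
    rw [← Finset.sum_add_distrib, ← Finset.sum_add_distrib]
    exact Finset.sum_congr rfl fun j _ => by simp only [hw, Matrix.mulVec, dotProduct]; ring
  have hwm : ∑ j, w j ^ 4 ≤ ∑ j, A.mulVec σ j ^ 4 := by
    refine Finset.sum_le_sum fun j _ => ?_
    have := S.abs_p_sub_le j (A.mulVec σ j + c j) (c j)
    rw [add_sub_cancel_right] at this
    rw [← Even.pow_abs (by decide : Even 4) (w j), ← Even.pow_abs (by decide : Even 4) (A.mulVec σ j)]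
    gcongr
  have hA : ∑ i, A.mulVec w i ^ 4 ≤ ρ ^ 4 * ∑ j, A.mulVec σ j ^ 4 :=
    (S.l4 w).trans (mul_le_mul_of_nonneg_left hwm (by have := S.rho_pos; positivity))
  have hB : ∀ i, (condSum A c p (A i) σ + A.mulVec (fun j => p j (c j)) i) ^ 4
      ≤ 8 * (condSum A c p (A i) σ ^ 4 + A.mulVec (fun j => p j (c j)) i ^ 4) := by
    intro i
    have := add_pow_four_le (by norm_num : (0 : ℝ) < 1 / 2) (by norm_num) (condSum A c p (A i) σ)
      (A.mulVec (fun j => p j (c j)) i)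
    norm_num at this
    linarith
  set M := ∑ i, A.mulVec σ i ^ 4 with hM
  set B := ∑ i, condSum A c p (A i) σ ^ 4 + ∑ i, A.mulVec (fun j => p j (c j)) i ^ 4 with hBdef
  have h3 : M ≤ ρ * M + 8 * B / (1 - ρ) ^ 3 := by
    calc M ≤ ∑ i, (A.mulVec w i ^ 4 / ρ ^ 3 + (8 * (condSum A c p (A i) σ ^ 4
            + A.mulVec (fun j => p j (c j)) i ^ 4)) / (1 - ρ) ^ 3) := by
          rw [hM]
          refine Finset.sum_le_sum fun i _ => ?_
          conv_lhs => rw [hdec i]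
          refine (add_pow_four_le S.rho_pos S.rho_lt _ _).trans ?_
          gcongr
          exact hB i
      _ = (∑ i, A.mulVec w i ^ 4) / ρ ^ 3 + 8 * B / (1 - ρ) ^ 3 := by
          rw [Finset.sum_add_distrib, ← Finset.sum_div, ← Finset.sum_div, ← Finset.mul_sum,
            Finset.sum_add_distrib]
      _ ≤ ρ ^ 4 * M / ρ ^ 3 + 8 * B / (1 - ρ) ^ 3 := by
          have := S.rho_pos
          gcongr
      _ = _ := by
          have := S.rho_pos.ne'
          field_simp
  have h4 : (1 - ρ) * M ≤ 8 * B / (1 - ρ) ^ 3 := by linarith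
  calc M = (1 - ρ) * M / (1 - ρ) := by field_simp
    _ ≤ (8 * B / (1 - ρ) ^ 3) / (1 - ρ) := by gcongr
    _ = _ := by field_simp

theorem integral_fieldNorm_le (S : SpinSystem A c p p' ρ al P) :
    ∫ σ, fieldNorm A σ ∂P ≤ 500 / (1 - ρ) ^ 2 *
      (√n * al + √(∑ i, A.mulVec (fun j => p j (c j)) i ^ 4)) := by
  have := S.prob
  have h1 : 0 < 1 - ρ := by linarith [S.rho_lt]
  have hf := continuous_field (A := A)
  have hc := S.continuous_condSum
  set R := ∑ i, A.mulVec (fun j => p j (c j)) i ^ 4 with hR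
  have hR0 : 0 ≤ R := Finset.sum_nonneg fun i _ => by positivity
  have h2 : ∫ σ, ∑ i, A.mulVec σ i ^ 4 ∂P
      ≤ 8 / (1 - ρ) ^ 4 * (24035 * (n * al ^ 2) + R) := by
    have h3 := integral_mono (μ := P) (S.integrable (by fun_prop)) (S.integrable (by fun_prop))
      S.sum_field_pow_four_le
    refine h3.trans ?_
    rw [integral_const_mul, integral_add (S.integrable (by fun_prop)) (integrable_const _),
      integral_finsetSum _ fun i _ => S.integrable (by fun_prop)]
    have h4 : ∑ i, ∫ σ, condSum A c p (A i) σ ^ 4 ∂P ≤ 24035 * (n * al ^ 2) := by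
      calc _ ≤ ∑ _i : Fin n, 24035 * al ^ 2 := by
            refine Finset.sum_le_sum fun i _ => (S.integral_condSum_pow_four_le _).trans ?_
            have : 0 ≤ ∑ j, A i j ^ 2 := Finset.sum_nonneg fun j _ => sq_nonneg _
            gcongr
            exact S.row i
        _ = _ := by simp; ring
    simp only [integral_const, probReal_univ, smul_eq_mul, one_mul]
    gcongr
  have hfn := continuous_fieldNorm (A := A)
  have e0 : ∀ σ, |fieldNorm A σ| = fieldNorm A σ := fun σ => abs_of_nonneg (Real.sqrt_nonneg _)
  have e1 : ∀ σ, fieldNorm A σ ^ 2 = ∑ i, A.mulVec σ i ^ 4 := fun σ =>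
    Real.sq_sqrt (Finset.sum_nonneg fun i _ => by positivity)
  have h5 := integral_abs_le_sqrt (S.integrable hfn) (S.integrable (by fun_prop))
  simp_rw [e0, e1] at h5
  refine h5.trans (Real.sqrt_le_iff.2 ⟨by have := S.al_nonneg; positivity, h2.trans ?_⟩)
  have ha := S.al_nonneg
  calc 8 / (1 - ρ) ^ 4 * (24035 * (n * al ^ 2) + R)
      ≤ 250000 / (1 - ρ) ^ 4 * ((√n * al) ^ 2 + √R ^ 2) := by
        rw [mul_pow, Real.sq_sqrt (Nat.cast_nonneg n), Real.sq_sqrt hR0, div_mul_eq_mul_div,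
          div_mul_eq_mul_div]
        have : (0 : ℝ) ≤ n * al ^ 2 := by positivity
        exact div_le_div_of_nonneg_right (by linarith) (by positivity)
    _ ≤ 250000 / (1 - ρ) ^ 4 * (√n * al + √R) ^ 2 := by
        gcongr
        have : 0 ≤ √n * al * √R := by positivity
        linarith
    _ = _ := by field_simp; ring

lemma sqrt_sum_field_sq_le (S : SpinSystem A c p p' ρ al P) (v : Fin n → ℝ) :
    √(∑ i, A.mulVec v i ^ 2) ≤ ρ * √(∑ i, v i ^ 2) := by
  refine (Real.sqrt_le_sqrt (S.l2 v)).trans ?_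
  rw [Real.sqrt_mul (sq_nonneg _), Real.sqrt_sq S.rho_pos.le]

lemma sqrt_sum_sq_add_le (x y : Fin n → ℝ) :
    √(∑ i, (x i + y i) ^ 2) ≤ √(∑ i, x i ^ 2) + √(∑ i, y i ^ 2) := by
  have := norm_add_le (WithLp.toLp 2 x) (WithLp.toLp 2 y)
  simpa [EuclideanSpace.norm_eq] using this

lemma sqrt_sum_mul_sq_le {d : Fin n → ℝ} (hd : ∀ i, 0 ≤ d i) (hd1 : ∀ i, d i ≤ 1)
    (v : Fin n → ℝ) : √(∑ i, (d i * v i) ^ 2) ≤ √(∑ i, v i ^ 2) := by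
  refine Real.sqrt_le_sqrt (Finset.sum_le_sum fun i _ => ?_)
  rw [mul_pow]
  exact mul_le_of_le_one_left (sq_nonneg _) (pow_le_one₀ (hd i) (hd1 i))

lemma exists_resolvent (S : SpinSystem A c p p' ρ al P) (r : Fin n → ℝ) :
    ∃ y : Fin n → ℝ, (∀ j, r j = y j - A.mulVec (fun i => p' i (c i) * y i) j) ∧
      √(∑ i, y i ^ 2) ≤ √(∑ i, r i ^ 2) / (1 - ρ) := by
  have h1 : 0 < 1 - ρ := by linarith [S.rho_lt]
  let L : (Fin n → ℝ) →ₗ[ℝ] (Fin n → ℝ) :=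
    LinearMap.id - (A * Matrix.diagonal fun i => p' i (c i)).mulVecLin
  have hL : ∀ y j, L y j = y j - A.mulVec (fun i => p' i (c i) * y i) j := by
    intro y j
    simp only [L, LinearMap.sub_apply, LinearMap.id_apply, Matrix.mulVecLin_apply, Pi.sub_apply]
    rw [← Matrix.mulVec_mulVec]
    congr 3
    ext i
    rw [Matrix.mulVec_diagonal]
  have hb : ∀ y, √(∑ i, y i ^ 2) * (1 - ρ) ≤ √(∑ i, L y i ^ 2) := by
    intro y
    have e := sqrt_sum_sq_add_le (L y) (fun j => A.mulVec (fun i => p' i (c i) * y i) j)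
    simp only [hL, sub_add_cancel] at e
    have e2 := S.sqrt_sum_field_sq_le (fun i => p' i (c i) * y i)
    have e3 := sqrt_sum_mul_sq_le (fun i => S.p'_nonneg i (c i)) (fun i => S.p'_le i (c i)) y
    have e4 := mul_le_mul_of_nonneg_left e3 S.rho_pos.le
    simp only [hL]
    linarith
  have hinj : Function.Injective L := by
    rw [← LinearMap.ker_eq_bot, LinearMap.ker_eq_bot']
    intro y hy
    have := hb y
    rw [hy] at this
    simp only [Pi.zero_apply, ne_eq, OfNat.ofNat_ne_zero, not_false_eq_true, zero_pow,
      Finset.sum_const_zero, Real.sqrt_zero] at this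
    have h0 : √(∑ i, y i ^ 2) ≤ 0 := by
      by_contra h
      have := mul_pos (not_le.1 h) h1
      linarith
    have h2 : ∑ i, y i ^ 2 = 0 :=
      le_antisymm (Real.sqrt_eq_zero'.1 (le_antisymm h0 (Real.sqrt_nonneg _)))
        (Finset.sum_nonneg fun i _ => sq_nonneg _)
    rw [Finset.sum_eq_zero_iff_of_nonneg fun i _ => sq_nonneg _] at h2
    ext i
    simpa using h2 i (Finset.mem_univ i)
  obtain ⟨y, hy⟩ := LinearMap.injective_iff_surjective.1 hinj r
  refine ⟨y, fun j => by rw [← hL, hy], ?_⟩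
  rw [le_div_iff₀ h1, ← hy]
  exact hb y

lemma dotProduct_mulVec_symm (S : SpinSystem A c p p' ρ al P) (x y : Fin n → ℝ) :
    ∑ i, A.mulVec x i * y i = ∑ i, x i * A.mulVec y i := by
  simp only [Matrix.mulVec, dotProduct, Finset.sum_mul, Finset.mul_sum]
  rw [Finset.sum_comm]
  refine Finset.sum_congr rfl fun i _ => Finset.sum_congr rfl fun j _ => ?_
  rw [S.symm j i]; ring

/-- Fluctuations of a linear functional around the noninteracting mean. -/
theorem integral_abs_linear_le (S : SpinSystem A c p p' ρ al P) (r : Fin n → ℝ) :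
    ∫ σ, |∑ i, r i * (σ i - p i (c i))| ∂P ≤ √(∑ i, r i ^ 2) / (1 - ρ) *
      (8 + 4 * ∫ σ, fieldNorm A σ ∂P + √(∑ i, A.mulVec (fun j => p j (c j)) i ^ 2)) := by
  have := S.prob
  obtain ⟨y, hy, hyr⟩ := S.exists_resolvent r
  set R := √(∑ i, A.mulVec (fun j => p j (c j)) i ^ 2) with hR
  set Y := √(∑ i, y i ^ 2) with hY
  have hY0 : 0 ≤ Y := Real.sqrt_nonneg _
  have hc := S.continuous_condSum
  have hfn := continuous_fieldNorm (A := A)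
  have hpt : ∀ σ, |∑ i, r i * (σ i - p i (c i))|
      ≤ |condSum A c p y σ| + 4 * Y * fieldNorm A σ + Y * R := by
    intro σ
    have e : ∑ i, r i * (σ i - p i (c i)) = condSum A c p y σ
        + ∑ i, y i * (p i (A.mulVec σ i + c i) - p i (c i) - p' i (c i) * A.mulVec σ i)
        + ∑ i, (p' i (c i) * y i) * A.mulVec (fun j => p j (c j)) i := by
      have e1 : ∑ i, r i * (σ i - p i (c i)) = ∑ i, y i * (σ i - p i (c i))
          - ∑ i, A.mulVec (fun i => p' i (c i) * y i) i * (σ i - p i (c i)) := by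
        rw [← Finset.sum_sub_distrib]
        exact Finset.sum_congr rfl fun i _ => by rw [hy i]; ring
      have e2 : ∀ i, A.mulVec (fun i => σ i - p i (c i)) i
          = A.mulVec σ i - A.mulVec (fun j => p j (c j)) i := fun i => by
        rw [← Pi.sub_apply, ← Matrix.mulVec_sub]; rfl
      rw [e1, S.dotProduct_mulVec_symm]
      simp_rw [e2, condSum]
      rw [← Finset.sum_sub_distrib, ← Finset.sum_add_distrib, ← Finset.sum_add_distrib]
      exact Finset.sum_congr rfl fun i _ => by ring
    rw [e]
    refine (abs_add_le _ _).trans (add_le_add ((abs_add_le _ _).trans (add_le_add le_rfl ?_)) ?_)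
    · refine (Finset.abs_sum_le_sum_abs _ _).trans ?_
      have h2 := sum_abs_mul_sq_le y (A.mulVec σ)
      calc _ ≤ ∑ i, 4 * (|y i| * A.mulVec σ i ^ 2) := by
            refine Finset.sum_le_sum fun i _ => ?_
            rw [abs_mul]
            have := S.taylor i (A.mulVec σ i + c i) (c i)
            rw [add_sub_cancel_right] at this
            calc _ ≤ |y i| * (4 * A.mulVec σ i ^ 2) := by gcongr
              _ = _ := by ring
        _ ≤ _ := by
            rw [← Finset.mul_sum, mul_assoc]
            exact mul_le_mul_of_nonneg_left h2 (by norm_num)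
    · refine (sq_sum_mul_le _ _).trans ?_
      gcongr
      exact sqrt_sum_mul_sq_le (fun i => S.p'_nonneg i (c i)) (fun i => S.p'_le i (c i)) y
  have h3 := integral_mono (μ := P) (S.integrable (by fun_prop)) (S.integrable (by fun_prop)) hpt
  rw [integral_add (S.integrable (by fun_prop)) (integrable_const _),
    integral_add (S.integrable (by fun_prop)) (S.integrable (by fun_prop)),
    integral_const_mul] at h3
  simp only [integral_const, probReal_univ, smul_eq_mul, one_mul] at h3
  have h4 := S.integral_abs_condSum_le y
  have hH : 0 ≤ ∫ σ, fieldNorm A σ ∂P := integral_nonneg fun σ => Real.sqrt_nonneg _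
  calc _ ≤ Y * (8 + 4 * ∫ σ, fieldNorm A σ ∂P + R) := by
        rw [← hY] at h4; linarith
    _ ≤ _ := by gcongr

end SpinSystem

/-! ### Normal approximation of linear statistics -/

/-- Linear statistic centred at the rescaled noninteracting means. -/
noncomputable def linStat {n : ℕ} (c : Fin n → ℝ) (p : Fin n → ℝ → ℝ) (q : Fin n → ℝ) (s : ℝ)
    (σ : Fin n → ℝ) : ℝ := ∑ i, q i * (σ i - p i (c i) / s)

/-- Continuous bump, equal to one within `r * δ` of `t` and supported within `(r + 1) * δ`. -/
noncomputable def bump (r t δ w : ℝ) : ℝ := max 0 (min 1 (r + 1 - |w - t| / δ))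

lemma continuous_bump (r t δ : ℝ) : Continuous (bump r t δ) := by
  unfold bump; fun_prop

lemma bump_nonneg (r t δ w : ℝ) : 0 ≤ bump r t δ w := le_max_left _ _

lemma bump_le_one (r t δ w : ℝ) : bump r t δ w ≤ 1 := max_le zero_le_one (min_le_left _ _)

lemma bump_eq_one {r t δ w : ℝ} (hδ : 0 < δ) (h : |w - t| ≤ r * δ) : bump r t δ w = 1 := by
  have : |w - t| / δ ≤ r := by rwa [div_le_iff₀ hδ]
  rw [bump, min_eq_left (by linarith), max_eq_right zero_le_one]

lemma bump_eq_zero {r t δ w : ℝ} (hδ : 0 < δ) (h : (r + 1) * δ ≤ |w - t|) :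
    bump r t δ w = 0 := by
  have : r + 1 ≤ |w - t| / δ := by rwa [le_div_iff₀ hδ]
  rw [bump, max_eq_left ((min_le_right _ _).trans (by linarith))]

lemma bump_le_bump {t δ x y : ℝ} (hδ : 0 < δ) (h : |x - y| ≤ 2 * δ) :
    bump 3 t δ x ≤ bump 6 t δ y := by
  by_cases hx : |x - t| ≤ 4 * δ
  · rw [bump_eq_one (w := y) hδ]
    · exact bump_le_one _ _ _ _
    · have := abs_sub_le y x t
      rw [abs_sub_comm y x] at this
      linarith
  · rw [bump_eq_zero hδ (by linarith [not_le.1 hx])]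
    exact bump_nonneg _ _ _ _

lemma abs_ramp_sub_le_bump {t δ x w : ℝ} (hδ : 0 < δ) (h : |w - x| ≤ 2 * δ) :
    |ramp t δ w - ramp t δ x| ≤ bump 3 t δ x := by
  rw [abs_le] at h
  by_cases hx : |x - t| ≤ 3 * δ
  · rw [bump_eq_one hδ hx, abs_le]
    constructor <;> linarith [(ramp_mem t δ w).1, (ramp_mem t δ w).2, (ramp_mem t δ x).1,
      (ramp_mem t δ x).2]
  · rcases lt_abs.1 (not_le.1 hx) with h1 | h1
    · rw [ramp_eq_zero hδ (by linarith), ramp_eq_zero hδ (by linarith)]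
      simpa using bump_nonneg _ _ _ _
    · rw [ramp_eq_one hδ (by linarith), ramp_eq_one hδ (by linarith)]
      simpa using bump_nonneg _ _ _ _

/-- Truncation of `w - t` at level `L`. -/
def clamp (L t w : ℝ) : ℝ := max (-L) (min L (w - t))

lemma mul_bump_le_mul_clamp_sub {t δ w u : ℝ} (hδ : 0 < δ) (hu : |u| ≤ 2 * δ) :
    u ^ 2 * bump 6 t δ (w - u) ≤ u * (clamp (9 * δ) t w - clamp (9 * δ) t (w - u)) := by
  by_cases h : |w - u - t| ≤ 7 * δ
  · rw [abs_le] at h hu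
    have e1 : clamp (9 * δ) t w = w - t := by
      rw [clamp, min_eq_right (by linarith), max_eq_right (by linarith)]
    have e2 : clamp (9 * δ) t (w - u) = w - u - t := by
      rw [clamp, min_eq_right (by linarith), max_eq_right (by linarith)]
    rw [e1, e2]
    have := bump_le_one 6 t δ (w - u)
    nlinarith [sq_nonneg u]
  · rw [bump_eq_zero hδ (by linarith [not_le.1 h]), mul_zero]
    have mono : ∀ a b, a ≤ b → clamp (9 * δ) t a ≤ clamp (9 * δ) t b := fun a b hab => by
      unfold clamp; gcongr
    rcases le_total 0 u with h0 | h0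
    · exact mul_nonneg h0 (sub_nonneg.2 (mono _ _ (by linarith)))
    · exact mul_nonneg_of_nonpos_of_nonpos h0 (sub_nonpos.2 (mono _ _ (by linarith)))

lemma abs_clamp_le {L : ℝ} (hL : 0 ≤ L) (t w : ℝ) : |clamp L t w| ≤ L := by
  rw [abs_le, clamp]
  exact ⟨le_max_left _ _, max_le (by linarith) (min_le_left _ _)⟩

namespace SpinSystem

variable {n : ℕ} {A : Matrix (Fin n) (Fin n) ℝ} {c : Fin n → ℝ} {p p' : Fin n → ℝ → ℝ}
  {ρ al : ℝ} {P : Measure (Fin n → ℝ)}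

lemma continuous_linStat (q : Fin n → ℝ) (s : ℝ) : Continuous (linStat c p q s) := by
  unfold linStat; fun_prop

lemma linStat_update (q : Fin n → ℝ) (s : ℝ) (σ : Fin n → ℝ) (j : Fin n) (x : ℝ) :
    linStat c p q s (Function.update σ j x) = linStat c p q s σ + q j * (x - σ j) := by
  unfold linStat
  rw [← sub_eq_iff_eq_add', ← Finset.sum_sub_distrib, Finset.sum_eq_single j]
  · simp; ring
  · intro k _ hk; simp [hk]
  · simp

/-- `linStat` with the `j`-th spin replaced by its conditional mean. -/
noncomputable def linStatErase (A : Matrix (Fin n) (Fin n) ℝ) (c : Fin n → ℝ) (p : Fin n → ℝ → ℝ)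
    (q : Fin n → ℝ) (s : ℝ) (j : Fin n) (σ : Fin n → ℝ) : ℝ :=
  linStat c p q s σ - q j * (σ j - p j (A.mulVec σ j + c j))

lemma linStatErase_update (S : SpinSystem A c p p' ρ al P) (q : Fin n → ℝ) (s : ℝ)
    (σ : Fin n → ℝ) (j : Fin n) (x : ℝ) :
    linStatErase A c p q s j (Function.update σ j x) = linStatErase A c p q s j σ := by
  unfold linStatErase
  rw [linStat_update, S.field_update_self]
  simp; ring

lemma continuous_linStatErase (S : SpinSystem A c p p' ρ al P) (q : Fin n → ℝ) (s : ℝ)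
    (j : Fin n) : Continuous (linStatErase A c p q s j) := by
  have h := S.continuous_mean j
  exact (continuous_linStat q s).sub
    (continuous_const.mul ((continuous_apply j).sub h))

lemma abs_incr_le (S : SpinSystem A c p p' ρ al P) {q : Fin n → ℝ} {δ : ℝ} (hq : ∀ i, |q i| ≤ δ)
    {σ : Fin n → ℝ} (hσ : ∀ i, |σ i| ≤ 1) (j : Fin n) :
    |q j * (σ j - p j (A.mulVec σ j + c j))| ≤ 2 * δ := by
  rw [abs_mul, mul_comm]
  exact mul_le_mul (S.abs_sub_mean_le hσ j _) (hq j) (abs_nonneg _) (by norm_num)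

lemma sum_var_sub_le (S : SpinSystem A c p p' ρ al P) {q : Fin n → ℝ} {δ : ℝ}
    (hq : ∀ i, |q i| ≤ δ) (hq2 : ∑ i, q i ^ 2 = 1) (σ : Fin n → ℝ) :
    ∑ i, q i ^ 2 * |p' i (A.mulVec σ i + c i) - p' i (c i)| ≤ 2 * δ + 2 * fieldNorm A σ := by
  have h1 := sum_abs_mul_sq_le q (A.mulVec σ)
  rw [hq2, Real.sqrt_one, one_mul] at h1
  calc _ ≤ ∑ i, (2 * (q i ^ 2 * δ) + 2 * (|q i| * A.mulVec σ i ^ 2)) := by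
        refine Finset.sum_le_sum fun i _ => ?_
        have h2 := S.lip i (A.mulVec σ i + c i) (c i)
        rw [add_sub_cancel_right] at h2
        have h3 : q i ^ 2 * |p' i (A.mulVec σ i + c i) - p' i (c i)|
            ≤ q i ^ 2 * (4 * |A.mulVec σ i|) := by gcongr
        have h4 : q i ^ 2 * |q i| ≤ q i ^ 2 * δ := by gcongr; exact hq i
        have h5 : q i ^ 2 * (4 * |A.mulVec σ i|)
            ≤ 2 * (q i ^ 2 * |q i|) + 2 * (|q i| * A.mulVec σ i ^ 2) := by
          rw [← sq_abs (q i), ← sq_abs (A.mulVec σ i)]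
          nlinarith [mul_nonneg (abs_nonneg (q i)) (sq_nonneg (|q i| - |A.mulVec σ i|))]
        linarith
    _ = 2 * ((∑ i, q i ^ 2) * δ) + 2 * ∑ i, |q i| * A.mulVec σ i ^ 2 := by
        rw [Finset.sum_add_distrib, ← Finset.mul_sum, ← Finset.mul_sum, Finset.sum_mul]
    _ ≤ _ := by rw [hq2, one_mul]; unfold fieldNorm; linarith

lemma sum_sq_mul_var_mem (S : SpinSystem A c p p' ρ al P) {q : Fin n → ℝ}
    (hq2 : ∑ i, q i ^ 2 = 1) (h : Fin n → ℝ) :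
    0 ≤ ∑ i, q i ^ 2 * p' i (h i) ∧ ∑ i, q i ^ 2 * p' i (h i) ≤ 1 := by
  refine ⟨Finset.sum_nonneg fun i _ => mul_nonneg (sq_nonneg _) (S.p'_nonneg _ _), ?_⟩
  rw [← hq2]
  exact Finset.sum_le_sum fun i _ => mul_le_of_le_one_right (sq_nonneg _) (S.p'_le _ _)

/-- Anti-concentration of the linear statistic. -/
theorem integral_bump_le (S : SpinSystem A c p p' ρ al P) {q : Fin n → ℝ} {δ κ : ℝ} (hδ : 0 < δ)
    (hq : ∀ i, |q i| ≤ δ) (hq2 : ∑ i, q i ^ 2 = 1) (hκ : κ ≤ ∑ i, q i ^ 2 * p' i (c i))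
    (s t : ℝ) :
    κ * ∫ σ, bump 3 t δ (linStat c p q s σ) ∂P ≤ 74 * δ + 2 * ∫ σ, fieldNorm A σ ∂P := by
  have := S.prob
  have hp := S.continuous_p
  have hp' := S.continuous_p'
  have hf := continuous_field (A := A)
  have hfn := continuous_fieldNorm (A := A)
  have hc := S.continuous_condSum
  have hT := continuous_linStat (c := c) (p := p) q s
  have hE := S.continuous_linStatErase q s
  have hb := continuous_bump
  have hcl : Continuous (clamp (9 * δ) t) := by unfold clamp; fun_prop
  have h1 := S.integral_condSum_mul q (G := fun σ => clamp (9 * δ) t (linStat c p q s σ))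
    (by fun_prop) (G' := fun j σ => clamp (9 * δ) t (linStatErase A c p q s j σ))
    (fun j => by fun_prop) (fun j σ x => by rw [S.linStatErase_update])
  have h2 : ∫ σ, condSum A c p q σ * clamp (9 * δ) t (linStat c p q s σ) ∂P ≤ 72 * δ := by
    have a := abs_integral_mul_le (S.integrable (hc q))
      (G := fun σ => clamp (9 * δ) t (linStat c p q s σ))
      (fun σ => abs_clamp_le (by positivity) t (linStat c p q s σ))
    have b := S.integral_abs_condSum_le q
    rw [hq2, Real.sqrt_one] at b
    nlinarith [le_abs_self (∫ σ, condSum A c p q σ * clamp (9 * δ) t (linStat c p q s σ) ∂P)]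
  have h3 : ∫ σ, ∑ j, q j ^ 2 * (((σ j - p j (A.mulVec σ j + c j)) ^ 2
      - p' j (A.mulVec σ j + c j)) * bump 6 t δ (linStatErase A c p q s j σ)) ∂P = 0 := by
    rw [integral_finsetSum _ fun j _ => S.integrable (by fun_prop)]
    refine Finset.sum_eq_zero fun j _ => ?_
    rw [integral_const_mul, S.var j (fun σ => bump 6 t δ (linStatErase A c p q s j σ))
      (by fun_prop) fun σ x => by rw [S.linStatErase_update], mul_zero]
  have h4 : ∀ᵐ σ ∂P, κ * bump 3 t δ (linStat c p q s σ)
      ≤ (∑ j, q j * ((σ j - p j (A.mulVec σ j + c j)) * (clamp (9 * δ) t (linStat c p q s σ)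
          - clamp (9 * δ) t (linStatErase A c p q s j σ))))
        - (∑ j, q j ^ 2 * (((σ j - p j (A.mulVec σ j + c j)) ^ 2
          - p' j (A.mulVec σ j + c j)) * bump 6 t δ (linStatErase A c p q s j σ)))
        + (2 * δ + 2 * fieldNorm A σ) := by
    filter_upwards [S.cube] with σ hσ
    set T := linStat c p q s σ with hTdef
    have k1 : (∑ j, q j ^ 2 * p' j (A.mulVec σ j + c j)) * bump 3 t δ T
        ≤ (∑ j, q j * ((σ j - p j (A.mulVec σ j + c j)) * (clamp (9 * δ) t T
          - clamp (9 * δ) t (linStatErase A c p q s j σ))))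
        - (∑ j, q j ^ 2 * (((σ j - p j (A.mulVec σ j + c j)) ^ 2
          - p' j (A.mulVec σ j + c j)) * bump 6 t δ (linStatErase A c p q s j σ))) := by
      rw [Finset.sum_mul, ← Finset.sum_sub_distrib]
      refine Finset.sum_le_sum fun j _ => ?_
      have hu := S.abs_incr_le hq hσ j
      have m1 := mul_bump_le_mul_clamp_sub (t := t) (w := T) hδ hu
      have m2 : bump 3 t δ T ≤ bump 6 t δ (linStatErase A c p q s j σ) :=
        bump_le_bump hδ (by simpa [linStatErase, hTdef] using hu)
      have m3 := mul_le_mul_of_nonneg_left m2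
        (mul_nonneg (sq_nonneg (q j)) (S.p'_nonneg j (A.mulVec σ j + c j)))
      rw [show T - q j * (σ j - p j (A.mulVec σ j + c j)) = linStatErase A c p q s j σ from rfl]
        at m1
      rw [mul_pow] at m1
      linarith
    have k2 : κ ≤ ∑ j, q j ^ 2 * p' j (A.mulVec σ j + c j) + (2 * δ + 2 * fieldNorm A σ) := by
      refine hκ.trans ?_
      have := S.sum_var_sub_le hq hq2 σ
      have k3 : ∑ i, q i ^ 2 * p' i (c i) ≤ ∑ j, q j ^ 2 * p' j (A.mulVec σ j + c j)
          + ∑ i, q i ^ 2 * |p' i (A.mulVec σ i + c i) - p' i (c i)| := by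
        rw [← Finset.sum_add_distrib]
        refine Finset.sum_le_sum fun i _ => ?_
        rw [← mul_add]
        have := neg_abs_le (p' i (A.mulVec σ i + c i) - p' i (c i))
        gcongr
        linarith
      linarith
    have b0 := bump_nonneg 3 t δ T
    have b1 := bump_le_one 3 t δ T
    have f0 : 0 ≤ fieldNorm A σ := Real.sqrt_nonneg _
    calc κ * bump 3 t δ T ≤ (∑ j, q j ^ 2 * p' j (A.mulVec σ j + c j)
          + (2 * δ + 2 * fieldNorm A σ)) * bump 3 t δ T := by gcongr
      _ ≤ (∑ j, q j ^ 2 * p' j (A.mulVec σ j + c j)) * bump 3 t δ T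
          + (2 * δ + 2 * fieldNorm A σ) := by
          rw [add_mul]
          have : (2 * δ + 2 * fieldNorm A σ) * bump 3 t δ T ≤ 2 * δ + 2 * fieldNorm A σ :=
            mul_le_of_le_one_right (by positivity) b1
          linarith
      _ ≤ _ := by linarith
  have h5 := integral_mono_ae (S.integrable (by fun_prop)) (S.integrable (by fun_prop)) h4
  rw [integral_add (S.integrable (by fun_prop)) (S.integrable (by fun_prop)),
    integral_sub (S.integrable (by fun_prop)) (S.integrable (by fun_prop)), h3, ← h1,
    integral_add (integrable_const _) (S.integrable (by fun_prop))] at h5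
  simp only [integral_const_mul, integral_const, probReal_univ, smul_eq_mul, one_mul] at h5
  linarith

/-- The rescaled linear statistic is close to the conditionally centred sum. -/
lemma integral_abs_linStat_sub_condSum_le (S : SpinSystem A c p p' ρ al P) {q r e : Fin n → ℝ}
    {υ lam : ℝ} (hq2 : ∑ i, q i ^ 2 = 1) (hυ0 : 0 ≤ υ) (hυ1 : υ ≤ 1) (hs : 1 - lam * υ ≠ 0)
    (hr : ∀ i, r i = A.mulVec (fun j => q j * (p' j (c j) - υ)) i)
    (he : ∀ i, e i = A.mulVec q i - lam * q i) :
    ∫ σ, |(1 - lam * υ) * linStat c p q (1 - lam * υ) σ - condSum A c p q σ| ∂P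
      ≤ 4 * ∫ σ, fieldNorm A σ ∂P + (√(∑ i, r i ^ 2) + √(∑ i, e i ^ 2)) / (1 - ρ) *
          (8 + 4 * ∫ σ, fieldNorm A σ ∂P + √(∑ i, A.mulVec (fun j => p j (c j)) i ^ 2))
        + |∑ i, r i * p i (c i)| + |∑ i, e i * p i (c i)| := by
  have := S.prob
  have hfn := continuous_fieldNorm (A := A)
  have hid : ∀ σ, (1 - lam * υ) * linStat c p q (1 - lam * υ) σ - condSum A c p q σ
      = ∑ i, q i * (p i (A.mulVec σ i + c i) - p i (c i) - p' i (c i) * A.mulVec σ i)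
        + (∑ i, r i * (σ i - p i (c i)) + ∑ i, r i * p i (c i))
        + υ * (∑ i, e i * (σ i - p i (c i)) + ∑ i, e i * p i (c i)) := by
    intro σ
    have h1 : ∑ i, q i * (p' i (c i) * A.mulVec σ i)
        = ∑ i, r i * σ i + υ * ∑ i, e i * σ i + lam * υ * ∑ i, q i * σ i := by
      have h2 := S.dotProduct_mulVec_symm (fun j => q j * (p' j (c j) - υ)) σ
      have h3 := S.dotProduct_mulVec_symm q σ
      have h4 : ∑ i, q i * (p' i (c i) * A.mulVec σ i)
          = ∑ i, q i * (p' i (c i) - υ) * A.mulVec σ i + υ * ∑ i, q i * A.mulVec σ i := by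
        rw [Finset.mul_sum, ← Finset.sum_add_distrib]
        exact Finset.sum_congr rfl fun i _ => by ring
      rw [h4, ← h2, ← h3]
      simp only [← hr, he, sub_mul, Finset.sum_sub_distrib, mul_assoc, ← Finset.mul_sum]
      ring
    have h5 : (1 - lam * υ) * linStat c p q (1 - lam * υ) σ
        = (1 - lam * υ) * ∑ i, q i * σ i - ∑ i, q i * p i (c i) := by
      unfold linStat
      rw [Finset.mul_sum, Finset.mul_sum, ← Finset.sum_sub_distrib]
      refine Finset.sum_congr rfl fun i _ => ?_
      field_simp
    have h6 : ∑ i, q i * (p i (A.mulVec σ i + c i) - p i (c i) - p' i (c i) * A.mulVec σ i)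
        = ∑ i, q i * p i (A.mulVec σ i + c i) - ∑ i, q i * p i (c i)
          - ∑ i, q i * (p' i (c i) * A.mulVec σ i) := by
      rw [← Finset.sum_sub_distrib, ← Finset.sum_sub_distrib]
      exact Finset.sum_congr rfl fun i _ => by ring
    have h7 : condSum A c p q σ
        = ∑ i, q i * σ i - ∑ i, q i * p i (A.mulVec σ i + c i) := by
      unfold condSum
      rw [← Finset.sum_sub_distrib]
      exact Finset.sum_congr rfl fun i _ => by ring
    rw [h5, h6, h7, h1]
    simp only [mul_sub, Finset.sum_sub_distrib]
    ring
  have hpt : ∀ σ, |(1 - lam * υ) * linStat c p q (1 - lam * υ) σ - condSum A c p q σ|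
      ≤ 4 * fieldNorm A σ + (|∑ i, r i * (σ i - p i (c i))| + |∑ i, e i * (σ i - p i (c i))|
        + (|∑ i, r i * p i (c i)| + |∑ i, e i * p i (c i)|)) := by
    intro σ
    rw [hid σ]
    have t1 : |∑ i, q i * (p i (A.mulVec σ i + c i) - p i (c i) - p' i (c i) * A.mulVec σ i)|
        ≤ 4 * fieldNorm A σ := by
      refine (Finset.abs_sum_le_sum_abs _ _).trans ?_
      have h := sum_abs_mul_sq_le q (A.mulVec σ)
      rw [hq2, Real.sqrt_one, one_mul] at h
      refine le_trans ?_ (mul_le_mul_of_nonneg_left h (by norm_num : (0 : ℝ) ≤ 4))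
      rw [Finset.mul_sum]
      refine Finset.sum_le_sum fun i _ => ?_
      rw [abs_mul, mul_left_comm]
      have := S.taylor i (A.mulVec σ i + c i) (c i)
      rw [add_sub_cancel_right] at this
      gcongr
    have t2 : |υ * (∑ i, e i * (σ i - p i (c i)) + ∑ i, e i * p i (c i))|
        ≤ |∑ i, e i * (σ i - p i (c i))| + |∑ i, e i * p i (c i)| := by
      rw [abs_mul, abs_of_nonneg hυ0]
      exact (mul_le_of_le_one_left (abs_nonneg _) hυ1).trans (abs_add_le _ _)
    have t3 := abs_add_le (∑ i, r i * (σ i - p i (c i))) (∑ i, r i * p i (c i))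
    have t4 := abs_add_three
      (∑ i, q i * (p i (A.mulVec σ i + c i) - p i (c i) - p' i (c i) * A.mulVec σ i))
      (∑ i, r i * (σ i - p i (c i)) + ∑ i, r i * p i (c i))
      (υ * (∑ i, e i * (σ i - p i (c i)) + ∑ i, e i * p i (c i)))
    linarith
  have hT := continuous_linStat (c := c) (p := p) q (1 - lam * υ)
  have hc := S.continuous_condSum q
  have hm := integral_mono (S.integrable (by fun_prop)) (S.integrable (by fun_prop)) hpt
  rw [integral_add (S.integrable (by fun_prop)) (S.integrable (by fun_prop)),
    integral_add (S.integrable (by fun_prop)) (integrable_const _),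
    integral_add (S.integrable (by fun_prop)) (S.integrable (by fun_prop))] at hm
  simp only [integral_const_mul, integral_const, probReal_univ, smul_eq_mul, one_mul] at hm
  have l1 := S.integral_abs_linear_le r
  have l2 := S.integral_abs_linear_le e
  refine hm.trans (le_trans ?_ (le_of_eq (add_assoc _ _ _).symm))
  rw [add_div, add_mul]
  linarith

/-- Approximate Stein identity for the linear statistic. -/
lemma abs_integral_condSum_mul_sub_le (S : SpinSystem A c p p' ρ al P) {q : Fin n → ℝ}
    {δ C : ℝ} (hq : ∀ i, |q i| ≤ δ) (hq2 : ∑ i, q i ^ 2 = 1) (s : ℝ) {f f' η : ℝ → ℝ}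
    (hf : ∀ w, HasDerivAt f (f' w) w) (hf' : Continuous f') (hC : ∀ w, |f' w| ≤ C)
    (hη : Continuous η) (hosc : ∀ w x, |w - x| ≤ 2 * δ → |f' w - f' x| ≤ η x) :
    |∫ σ, condSum A c p q σ * f (linStat c p q s σ) ∂P
        - (∑ i, q i ^ 2 * p' i (c i)) * ∫ σ, f' (linStat c p q s σ) ∂P|
      ≤ 9 * ∫ σ, η (linStat c p q s σ) ∂P + C * (2 * δ + 2 * ∫ σ, fieldNorm A σ ∂P) := by
  have := S.prob
  have hC0 : 0 ≤ C := (abs_nonneg _).trans (hC 0)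
  have hp := S.continuous_p
  have hp' := S.continuous_p'
  have hfield := continuous_field (A := A)
  have hfn := continuous_fieldNorm (A := A)
  have hT := continuous_linStat (c := c) (p := p) q s
  have hE := S.continuous_linStatErase q s
  have hfc : Continuous f := continuous_iff_continuousAt.2 fun w => (hf w).continuousAt
  set υ := ∑ i, q i ^ 2 * p' i (c i) with hυ
  have h1 := S.integral_condSum_mul q (G := fun σ => f (linStat c p q s σ))
    (by fun_prop) (G' := fun j σ => f (linStatErase A c p q s j σ))
    (fun j => by fun_prop) (fun j σ x => by rw [S.linStatErase_update])
  have h3 : ∫ σ, ∑ j, q j ^ 2 * (((σ j - p j (A.mulVec σ j + c j)) ^ 2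
      - p' j (A.mulVec σ j + c j)) * f' (linStatErase A c p q s j σ)) ∂P = 0 := by
    rw [integral_finsetSum _ fun j _ => S.integrable (by fun_prop)]
    refine Finset.sum_eq_zero fun j _ => ?_
    rw [integral_const_mul, S.var j (fun σ => f' (linStatErase A c p q s j σ))
      (by fun_prop) fun σ x => by rw [S.linStatErase_update], mul_zero]
  have h4 : ∀ᵐ σ ∂P, ‖∑ j, q j * ((σ j - p j (A.mulVec σ j + c j)) *
          (f (linStat c p q s σ) - f (linStatErase A c p q s j σ)))
        - ∑ j, q j ^ 2 * (((σ j - p j (A.mulVec σ j + c j)) ^ 2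
          - p' j (A.mulVec σ j + c j)) * f' (linStatErase A c p q s j σ))
        - υ * f' (linStat c p q s σ)‖
      ≤ 9 * η (linStat c p q s σ) + C * (2 * δ + 2 * fieldNorm A σ) := by
    filter_upwards [S.cube] with σ hσ
    set T := linStat c p q s σ with hTdef
    have hη0 : 0 ≤ η T := by
      refine (abs_nonneg _).trans (hosc T T ?_)
      have := (abs_nonneg _).trans (hq ⟨0, Nat.pos_of_ne_zero ?_⟩)
      · simpa using this
      · rintro rfl
        simp at hq2
    have hdec : ∑ j, q j * ((σ j - p j (A.mulVec σ j + c j)) *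
          (f T - f (linStatErase A c p q s j σ)))
        - ∑ j, q j ^ 2 * (((σ j - p j (A.mulVec σ j + c j)) ^ 2
          - p' j (A.mulVec σ j + c j)) * f' (linStatErase A c p q s j σ)) - υ * f' T
        = ∑ j, (q j * (σ j - p j (A.mulVec σ j + c j)) *
            (f T - f (linStatErase A c p q s j σ)
              - q j * (σ j - p j (A.mulVec σ j + c j)) * f' (linStatErase A c p q s j σ))
          + q j ^ 2 * p' j (A.mulVec σ j + c j) * (f' (linStatErase A c p q s j σ) - f' T)
          + q j ^ 2 * (p' j (A.mulVec σ j + c j) - p' j (c j)) * f' T) := by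
      rw [hυ, Finset.sum_mul, ← Finset.sum_sub_distrib, ← Finset.sum_sub_distrib]
      exact Finset.sum_congr rfl fun j _ => by ring
    rw [hdec, Real.norm_eq_abs]
    have hj : ∀ j, |q j * (σ j - p j (A.mulVec σ j + c j)) *
            (f T - f (linStatErase A c p q s j σ)
              - q j * (σ j - p j (A.mulVec σ j + c j)) * f' (linStatErase A c p q s j σ))
          + q j ^ 2 * p' j (A.mulVec σ j + c j) * (f' (linStatErase A c p q s j σ) - f' T)
          + q j ^ 2 * (p' j (A.mulVec σ j + c j) - p' j (c j)) * f' T|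
        ≤ q j ^ 2 * (9 * η T) + q j ^ 2 * |p' j (A.mulVec σ j + c j) - p' j (c j)| * C := by
      intro j
      have hu := S.abs_incr_le hq hσ j
      set u := q j * (σ j - p j (A.mulVec σ j + c j)) with hudef
      have hTj : linStatErase A c p q s j σ = T - u := rfl
      rw [hTj]
      have ho : |f' (T - u) - f' T| ≤ η T := hosc _ _ (by simpa using hu)
      have hinc : |f T - f (T - u) - u * f' (T - u)| ≤ 2 * η T * |u| := by
        have hmv := Convex.norm_image_sub_le_of_norm_hasDerivWithin_le (𝕜 := ℝ)
          (f := fun z => f z - f' (T - u) * z) (f' := fun z => f' z - f' (T - u))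
          (s := uIcc (T - u) T) (C := 2 * η T) (x := T - u) (y := T)
          (fun z _ => (((hf z).sub ((hasDerivAt_id z).const_mul (f' (T - u)))).congr_deriv
            (by simp)).hasDerivWithinAt)
          (fun z hz => by
            have hz1 : |z - T| ≤ 2 * δ := by
              have := abs_sub_right_of_mem_uIcc hz
              rw [sub_sub_cancel] at this
              rw [abs_sub_comm]
              exact this.trans hu
            rw [Real.norm_eq_abs]
            have := abs_sub_le (f' z) (f' T) (f' (T - u))
            have h2 := hosc z T hz1
            rw [abs_sub_comm] at ho
            linarith) (convex_uIcc _ _) left_mem_uIcc right_mem_uIcc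
        rw [sub_sub_cancel, Real.norm_eq_abs, Real.norm_eq_abs] at hmv
        refine le_trans (le_of_eq ?_) hmv
        congr 1; ring
      have hu2 : |u| * |u| ≤ 4 * q j ^ 2 := by
        have h2 := S.abs_sub_mean_le hσ j (A.mulVec σ j + c j)
        have h3 : |σ j - p j (A.mulVec σ j + c j)| ^ 2 ≤ 2 ^ 2 := by gcongr
        rw [hudef, abs_mul, ← sq_abs (q j)]
        nlinarith [sq_nonneg |q j|]
      have a1 : |u * (f T - f (T - u) - u * f' (T - u))| ≤ q j ^ 2 * (8 * η T) := by
        rw [abs_mul]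
        calc |u| * _ ≤ |u| * (2 * η T * |u|) := by gcongr
          _ = (|u| * |u|) * (2 * η T) := by ring
          _ ≤ 4 * q j ^ 2 * (2 * η T) := by gcongr
          _ = _ := by ring
      have a2 : |q j ^ 2 * p' j (A.mulVec σ j + c j) * (f' (T - u) - f' T)|
          ≤ q j ^ 2 * η T := by
        rw [abs_mul, abs_mul, abs_of_nonneg (sq_nonneg _), abs_of_nonneg (S.p'_nonneg _ _)]
        have := S.p'_le j (A.mulVec σ j + c j)
        calc _ ≤ q j ^ 2 * 1 * η T := by gcongr
          _ = _ := by ring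
      have a3 : |q j ^ 2 * (p' j (A.mulVec σ j + c j) - p' j (c j)) * f' T|
          ≤ q j ^ 2 * |p' j (A.mulVec σ j + c j) - p' j (c j)| * C := by
        rw [abs_mul, abs_mul, abs_of_nonneg (sq_nonneg _)]
        gcongr
        exact hC T
      have := abs_add_three (u * (f T - f (T - u) - u * f' (T - u)))
        (q j ^ 2 * p' j (A.mulVec σ j + c j) * (f' (T - u) - f' T))
        (q j ^ 2 * (p' j (A.mulVec σ j + c j) - p' j (c j)) * f' T)
      linarith
    refine (Finset.abs_sum_le_sum_abs _ _).trans ((Finset.sum_le_sum fun j _ => hj j).trans ?_)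
    rw [Finset.sum_add_distrib, ← Finset.sum_mul, ← Finset.sum_mul, hq2, one_mul, mul_comm C]
    have := S.sum_var_sub_le hq hq2 σ
    gcongr
  have h5 := norm_integral_le_of_norm_le (S.integrable (by fun_prop)) h4
  rw [integral_sub (S.integrable (by fun_prop)) (S.integrable (by fun_prop)),
    integral_sub (S.integrable (by fun_prop)) (S.integrable (by fun_prop)), h3, ← h1, sub_zero,
    integral_add (S.integrable (by fun_prop)) (S.integrable (by fun_prop))] at h5
  simp only [integral_const_mul] at h5
  rw [integral_add (integrable_const _) (S.integrable (by fun_prop))] at h5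
  simpa only [integral_const_mul, integral_const, probReal_univ, smul_eq_mul, one_mul,
    Real.norm_eq_abs] using h5

/-- Smooth Berry–Esseen estimate from Stein's equation. -/
lemma abs_integral_ramp_sub_le (S : SpinSystem A c p p' ρ al P) {q : Fin n → ℝ} {δ υ s v : ℝ}
    (hδ : 0 < δ) (hq : ∀ i, |q i| ≤ δ) (hq2 : ∑ i, q i ^ 2 = 1)
    (hυ : υ = ∑ i, q i ^ 2 * p' i (c i)) (hs : 0 < s) (hv : v = υ / s) (hv0 : 0 < v) (t : ℝ) :
    s * |∫ σ, ramp t δ (linStat c p q s σ) ∂P - ∫ x, ramp t δ x ∂gaussianReal 0 v.toNNReal|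
      ≤ 9 * ((2 * δ * (√(Real.pi * 2 / v) / 2 + 2 / v * ∫ σ, |linStat c p q s σ| ∂P)
          + ∫ σ, bump 3 t δ (linStat c p q s σ) ∂P) / v)
        + 2 / v * (2 * δ + 2 * ∫ σ, fieldNorm A σ ∂P)
        + √(Real.pi * 2 / v) / 2 * ∫ σ, |s * linStat c p q s σ - condSum A c p q σ| ∂P := by
  have := S.prob
  obtain ⟨f, f', hf, hf', heq, hf0, hf1⟩ := exists_stein_solution hv0 (continuous_ramp t δ)
    (ramp_mem t δ)
  set C₀ := √(Real.pi * 2 / v) / 2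
  set C₁ := 2 / v
  set N := ∫ x, ramp t δ x ∂gaussianReal 0 v.toNNReal
  have hT := continuous_linStat (c := c) (p := p) q s
  have hb := continuous_bump
  have hr := continuous_ramp
  have hc := S.continuous_condSum q
  have hfc : Continuous f := continuous_iff_continuousAt.2 fun w => (hf w).continuousAt
  have hosc : ∀ w x, |w - x| ≤ 2 * δ →
      |f' w - f' x| ≤ (2 * δ * (C₀ + C₁ * |x|) + bump 3 t δ x) / v := by
    intro w x hwx
    rw [le_div_iff₀' hv0]
    nth_rewrite 1 [← abs_of_pos hv0]
    rw [← abs_mul]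
    have e : v * (f' w - f' x) = (w - x) * f w + x * (f w - f x) + (ramp t δ w - ramp t δ x) := by
      have a := heq w
      have b := heq x
      linear_combination a - b
    have d : |f w - f x| ≤ C₁ * |w - x| := by
      simpa only [Real.norm_eq_abs] using Convex.norm_image_sub_le_of_norm_hasDerivWithin_le
        (f := f) (f' := f') (s := univ) (fun z _ => (hf z).hasDerivWithinAt)
        (fun z _ => hf1 z) convex_univ (mem_univ x) (mem_univ w)
    have hC₁ : 0 ≤ C₁ := by positivity
    have a1 : |(w - x) * f w| ≤ 2 * δ * C₀ := by
      rw [abs_mul]; gcongr; exact hf0 w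
    have a2 : |x * (f w - f x)| ≤ |x| * (C₁ * (2 * δ)) := by
      rw [abs_mul]; gcongr; exact d.trans (by gcongr)
    have a3 := abs_ramp_sub_le_bump (t := t) hδ hwx
    rw [e]
    refine (abs_add_three _ _ _).trans ?_
    linarith
  have h1 := S.abs_integral_condSum_mul_sub_le hq hq2 s hf hf' hf1
    (η := fun x => (2 * δ * (C₀ + C₁ * |x|) + bump 3 t δ x) / v) (by fun_prop) hosc
  have hη : ∫ σ, (2 * δ * (C₀ + C₁ * |linStat c p q s σ|) + bump 3 t δ (linStat c p q s σ)) / v ∂P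
      = (2 * δ * (C₀ + C₁ * ∫ σ, |linStat c p q s σ| ∂P)
          + ∫ σ, bump 3 t δ (linStat c p q s σ) ∂P) / v := by
    rw [integral_div, integral_add (S.integrable (by fun_prop)) (S.integrable (by fun_prop)),
      integral_const_mul, integral_add (integrable_const _) (S.integrable (by fun_prop))]
    simp only [integral_const_mul, integral_const, probReal_univ, smul_eq_mul, one_mul]
  rw [← hυ] at h1
  simp only [hη] at h1
  have h2 := abs_integral_mul_le
    (S.integrable (F := fun σ => s * linStat c p q s σ - condSum A c p q σ) (by fun_prop))
    (G := fun σ => f (linStat c p q s σ)) (fun σ => hf0 _)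
  have h3 : s * (∫ σ, ramp t δ (linStat c p q s σ) ∂P - N)
      = υ * ∫ σ, f' (linStat c p q s σ) ∂P - ∫ σ, condSum A c p q σ * f (linStat c p q s σ) ∂P
        - ∫ σ, (s * linStat c p q s σ - condSum A c p q σ) * f (linStat c p q s σ) ∂P := by
    have hsv : s * v = υ := by rw [hv]; field_simp
    rw [show N = ∫ _σ, N ∂P by simp, ← integral_const_mul,
      ← integral_sub (S.integrable (by fun_prop)) (integrable_const _), ← integral_const_mul,
      ← integral_sub (S.integrable (by fun_prop)) (S.integrable (by fun_prop)),
      ← integral_sub (S.integrable (by fun_prop)) (S.integrable (by fun_prop))]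
    refine integral_congr_ae (ae_of_all _ fun σ => ?_)
    simp only
    rw [← heq, ← hsv]
    ring
  nth_rewrite 1 [← abs_of_pos hs]
  rw [← abs_mul, h3]
  refine (abs_sub _ _).trans ?_
  rw [abs_sub_comm] at h1
  linarith

/-- Kolmogorov distance bound for linear statistics of spin systems. -/
theorem exists_dKS_le (ρ κ : ℝ) (hρ : ρ ∈ Ioo (0 : ℝ) 1) (hκ : 0 < κ) :
    ∃ K : ℝ, 0 < K ∧ ∀ {n : ℕ} {A : Matrix (Fin n) (Fin n) ℝ} {c : Fin n → ℝ}
      {p p' : Fin n → ℝ → ℝ} {al : ℝ} {P : Measure (Fin n → ℝ)}, SpinSystem A c p p' ρ al P →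
      ∀ {q : Fin n → ℝ} {δ υ lam : ℝ}, 0 < δ → δ ≤ 1 → (∀ i, |q i| ≤ δ) → ∑ i, q i ^ 2 = 1 →
      υ = ∑ i, q i ^ 2 * p' i (c i) → κ ≤ υ → |lam| ≤ ρ →
      dKS (P.map (linStat c p q (1 - lam * υ)))
          (gaussianReal 0 (υ / (1 - lam * υ)).toNNReal)
        ≤ K * (δ + ∫ σ, fieldNorm A σ ∂P + ∫ σ, |(1 - lam * υ) * linStat c p q (1 - lam * υ) σ
            - condSum A c p q σ| ∂P) := by
  have h1 : 0 < 1 - ρ := by linarith [hρ.2]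
  set c₀ := √(Real.pi * 4 / κ) / 2 with hc₀
  set K' := 9 * ((2 * (c₀ + 4 / κ * (8 / (1 - ρ))) + 74 / κ) * (2 / κ)) + 8 / κ + c₀ with hK'
  have hK'0 : 0 ≤ K' := by positivity
  refine ⟨K' / (1 - ρ) + 1 / √(Real.pi * κ), by positivity, ?_⟩
  intro n A c p p' al P S q δ υ lam hδ hδ1 hq hq2 hυ hκυ hlam
  have := S.prob
  have hυ1 : υ ≤ 1 := hυ ▸ (S.sum_sq_mul_var_mem hq2 c).2
  have hυ0 : 0 < υ := hκ.trans_le hκυ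
  set s := 1 - lam * υ with hs
  have hlu : |lam * υ| ≤ ρ := by
    rw [abs_mul, abs_of_pos hυ0]
    exact (mul_le_of_le_one_right (abs_nonneg _) hυ1).trans hlam
  rw [abs_le] at hlu
  have hs1 : 1 - ρ ≤ s := by linarith
  have hs0 : 0 < s := h1.trans_le hs1
  have hs2 : s ≤ 2 := by linarith [hρ.2]
  set v := υ / s with hv
  have hv0 : 0 < v := div_pos hυ0 hs0
  have hvκ : κ / 2 ≤ v := div_le_div₀ hυ0.le hκυ hs0 hs2
  set H := ∫ σ, fieldNorm A σ ∂P with hH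
  have hH0 : 0 ≤ H := integral_nonneg fun σ => Real.sqrt_nonneg _
  set B := ∫ σ, |s * linStat c p q s σ - condSum A c p q σ| ∂P with hB
  have hB0 : 0 ≤ B := integral_nonneg fun σ => abs_nonneg _
  set D := δ + H + B with hD
  have hT := continuous_linStat (c := c) (p := p) q s
  have hcs := S.continuous_condSum q
  have hET : ∫ σ, |linStat c p q s σ| ∂P ≤ (8 + B) / (1 - ρ) := by
    rw [le_div_iff₀ h1, mul_comm]
    have a : ∀ σ, (1 - ρ) * |linStat c p q s σ|
        ≤ |condSum A c p q σ| + |s * linStat c p q s σ - condSum A c p q σ| := fun σ => by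
      have a1 := mul_le_mul_of_nonneg_right hs1 (abs_nonneg (linStat c p q s σ))
      have a2 := abs_add_le (condSum A c p q σ) (s * linStat c p q s σ - condSum A c p q σ)
      rw [add_sub_cancel, abs_mul, abs_of_pos hs0] at a2
      linarith
    have b := integral_mono (S.integrable (by fun_prop)) (S.integrable (by fun_prop)) a
    rw [integral_const_mul, integral_add (S.integrable (by fun_prop)) (S.integrable (by fun_prop))]
      at b
    have d := S.integral_abs_condSum_le q
    rw [hq2, Real.sqrt_one, mul_one] at d
    linarith
  have hC₁ : 2 / v ≤ 4 / κ := by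
    rw [div_le_div_iff₀ hv0 hκ]; linarith
  have hC₀ : √(Real.pi * 2 / v) / 2 ≤ c₀ := by
    rw [hc₀, mul_div_assoc, mul_div_assoc]
    gcongr
  have hE : ∀ t, |∫ x, ramp t δ x ∂(P.map (linStat c p q s))
      - ∫ x, ramp t δ x ∂gaussianReal 0 v.toNNReal| ≤ K' / (1 - ρ) * D := by
    intro t
    rw [integral_map hT.aemeasurable (continuous_ramp t δ).aestronglyMeasurable]
    have e := S.abs_integral_ramp_sub_le hδ hq hq2 hυ hs0 hv hv0 t
    have hb := S.integral_bump_le hδ hq hq2 (hυ ▸ hκυ) s t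
    have hb' : ∫ σ, bump 3 t δ (linStat c p q s σ) ∂P ≤ 74 / κ * D := by
      rw [div_mul_eq_mul_div, le_div_iff₀ hκ, mul_comm]
      linarith
    have hET' : δ * ∫ σ, |linStat c p q s σ| ∂P ≤ 8 / (1 - ρ) * D := by
      calc _ ≤ δ * ((8 + B) / (1 - ρ)) := by gcongr
        _ = (8 * δ + δ * B) / (1 - ρ) := by ring
        _ ≤ (8 * δ + 1 * B) / (1 - ρ) := by gcongr
        _ ≤ (8 * D) / (1 - ρ) := by gcongr; linarith
        _ = _ := by ring
    have hETn : 0 ≤ ∫ σ, |linStat c p q s σ| ∂P := integral_nonneg fun σ => abs_nonneg _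
    have hbn : 0 ≤ ∫ σ, bump 3 t δ (linStat c p q s σ) ∂P :=
      integral_nonneg fun σ => bump_nonneg _ _ _ _
    have hD0 : 0 ≤ D := by positivity
    have hδD : δ ≤ D := by linarith
    have hBD : B ≤ D := by linarith
    have m1 : (2 * δ * (√(Real.pi * 2 / v) / 2 + 2 / v * ∫ σ, |linStat c p q s σ| ∂P)
          + ∫ σ, bump 3 t δ (linStat c p q s σ) ∂P) / v
        ≤ (2 * (c₀ + 4 / κ * (8 / (1 - ρ))) + 74 / κ) * (2 / κ) * D := by
      have hvi : 1 / v ≤ 2 / κ := by rw [div_le_div_iff₀ hv0 hκ]; linarith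
      calc _ = (2 * (δ * (√(Real.pi * 2 / v) / 2)
            + 2 / v * (δ * ∫ σ, |linStat c p q s σ| ∂P))
          + ∫ σ, bump 3 t δ (linStat c p q s σ) ∂P) * (1 / v) := by ring
        _ ≤ (2 * (D * c₀ + 4 / κ * (8 / (1 - ρ) * D)) + 74 / κ * D) * (2 / κ) := by
          gcongr
        _ = _ := by ring
    have m2 : 2 / v * (2 * δ + 2 * H) ≤ 8 / κ * D := by
      calc _ ≤ 4 / κ * (2 * D) := by gcongr; linarith
        _ = _ := by ring
    have m3 : √(Real.pi * 2 / v) / 2 * B ≤ c₀ * D := by gcongr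
    rw [div_mul_eq_mul_div, le_div_iff₀ h1, mul_comm]
    refine (mul_le_mul_of_nonneg_right hs1 (abs_nonneg _)).trans (e.trans ?_)
    rw [hK', add_mul, add_mul]
    linarith
  have : IsProbabilityMeasure (P.map (linStat c p q s)) :=
    Measure.isProbabilityMeasure_map hT.aemeasurable
  refine (dKS_le_of_ramp _ hv0 hδ hE).trans ?_
  rw [add_mul]
  gcongr
  calc δ / √(2 * Real.pi * v) ≤ D / √(Real.pi * κ) := by
        have : Real.pi * κ ≤ 2 * Real.pi * v := by
          nlinarith [Real.pi_pos]
        gcongr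
        linarith
    _ = _ := by ring

end SpinSystem

/-! ### Exponential tilts of a base measure -/

/-- Unnormalised moments of the exponentially tilted measure. -/
noncomputable def tiltMoment (ν : Measure ℝ) (k : ℕ) (θ : ℝ) : ℝ :=
  ∫ z, z ^ k * Real.exp (θ * z) ∂ν

namespace GoodBase

variable {ν : Measure ℝ}

lemma ae_abs_le (h : GoodBase ν) : ∀ᵐ z ∂ν, |z| ≤ 1 := by
  have : ∀ᵐ z ∂ν, z ∈ Icc (-1 : ℝ) 1 := mem_ae_iff.2 h.supp
  filter_upwards [this] with z hz using abs_le.2 hz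

lemma interior_integrableExpSet (h : GoodBase ν) : interior (integrableExpSet id ν) = univ := by
  have := h.prob
  rw [show integrableExpSet id ν = univ from eq_univ_of_forall fun t =>
    integrable_exp_mul_of_mem_Icc aemeasurable_id
      (h.ae_abs_le.mono fun z hz => abs_le.1 hz), interior_univ]

lemma integrable_pow_mul_exp (h : GoodBase ν) (k : ℕ) (θ : ℝ) :
    Integrable (fun z => z ^ k * Real.exp (θ * z)) ν :=
  integrable_pow_mul_exp_of_mem_interior_integrableExpSet (X := id)
    (h.interior_integrableExpSet ▸ mem_univ θ) k

lemma hasDerivAt_tiltMoment (h : GoodBase ν) (k : ℕ) (θ : ℝ) :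
    HasDerivAt (tiltMoment ν k) (tiltMoment ν (k + 1) θ) θ :=
  hasDerivAt_integral_pow_mul_exp_real (X := id) (h.interior_integrableExpSet ▸ mem_univ θ) k

lemma tiltMoment_zero_pos (h : GoodBase ν) (θ : ℝ) : 0 < tiltMoment ν 0 θ := by
  have := h.prob
  have hi := h.integrable_pow_mul_exp 0 θ
  simp only [pow_zero, one_mul] at hi
  simpa [tiltMoment] using integral_exp_pos hi

lemma abs_tiltMoment_le (h : GoodBase ν) (k : ℕ) (θ : ℝ) :
    |tiltMoment ν k θ| ≤ tiltMoment ν 0 θ := by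
  refine norm_integral_le_of_norm_le (f := fun z => z ^ k * Real.exp (θ * z))
    (h.integrable_pow_mul_exp 0 θ) ?_
  filter_upwards [h.ae_abs_le] with z hz
  rw [norm_mul, norm_pow, Real.norm_eq_abs, Real.norm_eq_abs, Real.abs_exp, pow_zero]
  gcongr
  exact pow_le_one₀ (abs_nonneg _) hz

lemma psiD_eq (h : GoodBase ν) (θ : ℝ) :
    psiD ν θ = tiltMoment ν 1 θ / tiltMoment ν 0 θ := by
  have e : logMGF ν = fun θ => Real.log (tiltMoment ν 0 θ) := by
    ext θ; simp [logMGF, tiltMoment]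
  rw [psiD, e]
  exact ((h.hasDerivAt_tiltMoment 0 θ).log (h.tiltMoment_zero_pos θ).ne').deriv

lemma psiDD_eq (h : GoodBase ν) (θ : ℝ) :
    psiDD ν θ = tiltMoment ν 2 θ / tiltMoment ν 0 θ
      - (tiltMoment ν 1 θ / tiltMoment ν 0 θ) ^ 2 := by
  have e : deriv (logMGF ν) = fun θ => tiltMoment ν 1 θ / tiltMoment ν 0 θ :=
    funext h.psiD_eq
  have h0 := (h.tiltMoment_zero_pos θ).ne'
  rw [psiDD, e, ((h.hasDerivAt_tiltMoment 1 θ).fun_div (h.hasDerivAt_tiltMoment 0 θ) h0).deriv]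
  field_simp

lemma hasDerivAt_psiD (h : GoodBase ν) (θ : ℝ) : HasDerivAt (psiD ν) (psiDD ν θ) θ := by
  have h0 := (h.tiltMoment_zero_pos θ).ne'
  rw [show psiD ν = fun θ => tiltMoment ν 1 θ / tiltMoment ν 0 θ from funext h.psiD_eq, h.psiDD_eq]
  refine ((h.hasDerivAt_tiltMoment 1 θ).fun_div (h.hasDerivAt_tiltMoment 0 θ) h0).congr_deriv ?_
  field_simp

lemma abs_tiltMoment_div_le (h : GoodBase ν) (k : ℕ) (θ : ℝ) :
    |tiltMoment ν k θ / tiltMoment ν 0 θ| ≤ 1 := by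
  rw [abs_div, abs_of_pos (h.tiltMoment_zero_pos θ)]
  exact div_le_one_of_le₀ (h.abs_tiltMoment_le k θ) (h.tiltMoment_zero_pos θ).le

lemma abs_psiD_le (h : GoodBase ν) (θ : ℝ) : |psiD ν θ| ≤ 1 :=
  h.psiD_eq θ ▸ h.abs_tiltMoment_div_le 1 θ

lemma integral_sub_psiD_mul_exp (h : GoodBase ν) (θ : ℝ) :
    ∫ z, (z - psiD ν θ) * Real.exp (θ * z) ∂ν = 0 := by
  have h0 := (h.tiltMoment_zero_pos θ).ne'
  have e : ∀ z, (z - psiD ν θ) * Real.exp (θ * z)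
      = z ^ 1 * Real.exp (θ * z) - psiD ν θ * (z ^ 0 * Real.exp (θ * z)) := fun z => by ring
  simp only [e]
  rw [integral_sub (h.integrable_pow_mul_exp 1 θ) ((h.integrable_pow_mul_exp 0 θ).const_mul _),
    integral_const_mul, h.psiD_eq]
  change tiltMoment ν 1 θ - _ * tiltMoment ν 0 θ = 0
  field_simp
  ring

lemma integrable_sub_sq_mul_exp (h : GoodBase ν) (a θ : ℝ) :
    Integrable (fun z => (z - a) ^ 2 * Real.exp (θ * z)) ν := by
  refine (((h.integrable_pow_mul_exp 2 θ).sub ((h.integrable_pow_mul_exp 1 θ).const_mul (2 * a))).add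
    ((h.integrable_pow_mul_exp 0 θ).const_mul (a ^ 2))).congr (ae_of_all _ fun z => ?_)
  simp only [Pi.add_apply, Pi.sub_apply]
  ring

lemma integral_sub_psiD_sq_mul_exp (h : GoodBase ν) (θ : ℝ) :
    ∫ z, (z - psiD ν θ) ^ 2 * Real.exp (θ * z) ∂ν = psiDD ν θ * tiltMoment ν 0 θ := by
  have h0 := (h.tiltMoment_zero_pos θ).ne'
  have e : ∀ z, (z - psiD ν θ) ^ 2 * Real.exp (θ * z)
      = z ^ 2 * Real.exp (θ * z) - 2 * psiD ν θ * (z ^ 1 * Real.exp (θ * z))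
        + psiD ν θ ^ 2 * (z ^ 0 * Real.exp (θ * z)) := fun z => by ring
  have i0 := (h.integrable_pow_mul_exp 0 θ).const_mul (psiD ν θ ^ 2)
  have i1 := (h.integrable_pow_mul_exp 1 θ).const_mul (2 * psiD ν θ)
  have i2 : Integrable (fun z => z ^ 2 * Real.exp (θ * z)
      - 2 * psiD ν θ * (z ^ 1 * Real.exp (θ * z))) ν := (h.integrable_pow_mul_exp 2 θ).sub i1
  simp only [e]
  rw [integral_add i2 i0, integral_sub (h.integrable_pow_mul_exp 2 θ) i1, integral_const_mul,
    integral_const_mul, h.psiDD_eq, h.psiD_eq]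
  change tiltMoment ν 2 θ - _ * tiltMoment ν 1 θ + _ * tiltMoment ν 0 θ = _
  field_simp
  ring

lemma integral_sub_psiD_sq_sub_psiDD_mul_exp (h : GoodBase ν) (θ : ℝ) :
    ∫ z, ((z - psiD ν θ) ^ 2 - psiDD ν θ) * Real.exp (θ * z) ∂ν = 0 := by
  have e : ∀ z, ((z - psiD ν θ) ^ 2 - psiDD ν θ) * Real.exp (θ * z)
      = (z - psiD ν θ) ^ 2 * Real.exp (θ * z) - psiDD ν θ * (z ^ 0 * Real.exp (θ * z)) :=
    fun z => by ring
  simp only [e]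
  rw [integral_sub (h.integrable_sub_sq_mul_exp _ θ) ((h.integrable_pow_mul_exp 0 θ).const_mul _),
    integral_const_mul, h.integral_sub_psiD_sq_mul_exp]
  exact sub_self _

lemma psiDD_nonneg (h : GoodBase ν) (θ : ℝ) : 0 ≤ psiDD ν θ := by
  have h1 : 0 ≤ psiDD ν θ * tiltMoment ν 0 θ := by
    rw [← h.integral_sub_psiD_sq_mul_exp]
    exact integral_nonneg fun z => by positivity
  exact nonneg_of_mul_nonneg_left h1 (h.tiltMoment_zero_pos θ)

lemma psiDD_le (h : GoodBase ν) (θ : ℝ) : psiDD ν θ ≤ 1 := by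
  rw [h.psiDD_eq]
  linarith [le_of_abs_le (h.abs_tiltMoment_div_le 2 θ),
    sq_nonneg (tiltMoment ν 1 θ / tiltMoment ν 0 θ)]

lemma abs_psiDD_sub_le (h : GoodBase ν) (x y : ℝ) : |psiDD ν x - psiDD ν y| ≤ 4 * |x - y| := by
  have hm : ∀ k θ, HasDerivAt (fun θ => tiltMoment ν k θ / tiltMoment ν 0 θ)
      (tiltMoment ν (k + 1) θ / tiltMoment ν 0 θ
        - tiltMoment ν k θ / tiltMoment ν 0 θ * (tiltMoment ν 1 θ / tiltMoment ν 0 θ)) θ := by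
    intro k θ
    have h0 := (h.tiltMoment_zero_pos θ).ne'
    refine ((h.hasDerivAt_tiltMoment k θ).fun_div (h.hasDerivAt_tiltMoment 0 θ) h0).congr_deriv ?_
    field_simp
  have hd : ∀ θ, HasDerivAt (psiDD ν) (tiltMoment ν 3 θ / tiltMoment ν 0 θ
      - tiltMoment ν 2 θ / tiltMoment ν 0 θ * (tiltMoment ν 1 θ / tiltMoment ν 0 θ)
      - 2 * (tiltMoment ν 1 θ / tiltMoment ν 0 θ) * psiDD ν θ) θ := by
    intro θ
    rw [show psiDD ν = fun θ => tiltMoment ν 2 θ / tiltMoment ν 0 θ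
      - (tiltMoment ν 1 θ / tiltMoment ν 0 θ) ^ 2 from funext h.psiDD_eq]
    refine ((hm 2 θ).sub ((hm 1 θ).pow 2)).congr_deriv ?_
    norm_num [-mul_eq_mul_left_iff]
    ring
  have hb : ∀ θ, ‖tiltMoment ν 3 θ / tiltMoment ν 0 θ
      - tiltMoment ν 2 θ / tiltMoment ν 0 θ * (tiltMoment ν 1 θ / tiltMoment ν 0 θ)
      - 2 * (tiltMoment ν 1 θ / tiltMoment ν 0 θ) * psiDD ν θ‖ ≤ 4 := by
    intro θ
    have m1 := h.abs_tiltMoment_div_le 1 θ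
    have m2 := h.abs_tiltMoment_div_le 2 θ
    have m3 := h.abs_tiltMoment_div_le 3 θ
    have p0 := h.psiDD_nonneg θ
    have p1 := h.psiDD_le θ
    have a := abs_mul (tiltMoment ν 2 θ / tiltMoment ν 0 θ) (tiltMoment ν 1 θ / tiltMoment ν 0 θ)
      ▸ mul_le_one₀ m2 (abs_nonneg _) m1
    have b := abs_mul (tiltMoment ν 1 θ / tiltMoment ν 0 θ) (psiDD ν θ)
      ▸ mul_le_one₀ m1 (abs_nonneg _) ((abs_of_nonneg p0).le.trans p1)
    rw [abs_le] at m3 a b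
    rw [Real.norm_eq_abs, abs_le]
    constructor <;> linarith
  simpa only [Real.norm_eq_abs] using Convex.norm_image_sub_le_of_norm_hasDerivWithin_le
    (f := psiDD ν) (s := univ) (fun θ _ => (hd θ).hasDerivWithinAt) (fun θ _ => hb θ)
    convex_univ (mem_univ y) (mem_univ x)

end GoodBase

/-! ### The operator norm and spectral bounds -/

lemma pNorm_four {n : ℕ} (v : Fin n → ℝ) : pNorm 4 v = (∑ i, v i ^ 4) ^ (1 / 4 : ℝ) := by
  have h4 : ((4 : ℝ≥0∞)).toReal = 4 := by norm_num
  rw [pNorm, if_neg (by norm_num), h4]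
  congr 1
  refine Finset.sum_congr rfl fun i _ => ?_
  rw [show (4 : ℝ) = ((4 : ℕ) : ℝ) by norm_num, Real.rpow_natCast, Even.pow_abs (by decide)]

lemma pNorm_two {n : ℕ} (v : Fin n → ℝ) : pNorm 2 v = √(∑ i, v i ^ 2) := by
  rw [pNorm, if_neg (by norm_num), Real.sqrt_eq_rpow, ENNReal.toReal_ofNat]
  congr 1
  refine Finset.sum_congr rfl fun i _ => ?_
  rw [Real.rpow_two, sq_abs]

lemma pNorm_four_pow {n : ℕ} (v : Fin n → ℝ) : pNorm 4 v ^ 4 = ∑ i, v i ^ 4 := by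
  rw [pNorm_four, ← Real.rpow_mul_natCast (Finset.sum_nonneg fun i _ => by positivity)]
  norm_num

lemma pNorm_four_nonneg {n : ℕ} (v : Fin n → ℝ) : 0 ≤ pNorm 4 v := by
  rw [pNorm_four]
  exact Real.rpow_nonneg (Finset.sum_nonneg fun i _ => by positivity) _

lemma pNorm_four_smul {n : ℕ} (a : ℝ) (v : Fin n → ℝ) : pNorm 4 (a • v) = |a| * pNorm 4 v := by
  rw [← pow_left_inj₀ (pNorm_four_nonneg _) (mul_nonneg (abs_nonneg _) (pNorm_four_nonneg _))
    (by norm_num : 4 ≠ 0), mul_pow, pNorm_four_pow, pNorm_four_pow, Even.pow_abs (by decide),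
    Finset.mul_sum]
  exact Finset.sum_congr rfl fun i _ => by simp [mul_pow]

lemma bddAbove_pNorm_four_mulVec {n : ℕ} (M : Matrix (Fin n) (Fin n) ℝ) :
    BddAbove {x | ∃ v : Fin n → ℝ, pNorm 4 v ≤ 1 ∧ x = pNorm 4 (M.mulVec v)} := by
  refine ⟨(∑ i, (∑ j, |M i j|) ^ 4) ^ (1 / 4 : ℝ), ?_⟩
  rintro _ ⟨v, hv, rfl⟩
  have hv4 : ∑ i, v i ^ 4 ≤ 1 := by
    rw [← pNorm_four_pow]; exact pow_le_one₀ (pNorm_four_nonneg v) hv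
  have hvj : ∀ j, |v j| ≤ 1 := fun j => by
    have := (Finset.single_le_sum (f := fun i => v i ^ 4) (fun i _ => by positivity)
      (Finset.mem_univ j)).trans hv4
    rw [← Even.pow_abs (by decide : Even 4)] at this
    exact (pow_le_one_iff_of_nonneg (abs_nonneg _) (by norm_num)).1 this
  rw [pNorm_four]
  refine Real.rpow_le_rpow (Finset.sum_nonneg fun i _ => by positivity)
    (Finset.sum_le_sum fun i _ => ?_) (by norm_num)
  rw [← Even.pow_abs (by decide : Even 4)]
  refine pow_le_pow_left₀ (abs_nonneg _) ?_ 4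
  rw [Matrix.mulVec, dotProduct]
  refine (Finset.abs_sum_le_sum_abs _ _).trans (Finset.sum_le_sum fun j _ => ?_)
  rw [abs_mul]
  exact mul_le_of_le_one_right (abs_nonneg _) (hvj j)

lemma sum_mulVec_pow_four_le {n : ℕ} {A : Matrix (Fin n) (Fin n) ℝ} {ρ : ℝ} (hA : opNorm 4 A ≤ ρ)
    (v : Fin n → ℝ) : ∑ i, A.mulVec v i ^ 4 ≤ ρ ^ 4 * ∑ i, v i ^ 4 := by
  rw [← pNorm_four_pow, ← pNorm_four_pow, ← mul_pow]
  refine pow_le_pow_left₀ (pNorm_four_nonneg _) ?_ 4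
  rcases (pNorm_four_nonneg v).eq_or_lt with h0 | h0
  · have hv : ∀ i, v i = 0 := fun i => by
      have h1 : ∑ i, v i ^ 4 = 0 := by rw [← pNorm_four_pow, ← h0]; norm_num
      have := (Finset.sum_eq_zero_iff_of_nonneg fun i _ => (by positivity : 0 ≤ v i ^ 4)).1 h1 i (Finset.mem_univ i)
      exact pow_eq_zero_iff (by norm_num) |>.1 this
    obtain rfl : v = 0 := funext hv
    rw [Matrix.mulVec_zero, ← h0, mul_zero]
  · have h1 : pNorm 4 (A.mulVec ((pNorm 4 v)⁻¹ • v)) ≤ opNorm 4 A := by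
      refine le_csSup (bddAbove_pNorm_four_mulVec A) ⟨_, ?_, rfl⟩
      rw [pNorm_four_smul, abs_of_pos (inv_pos.2 h0), inv_mul_cancel₀ h0.ne']
    rw [Matrix.mulVec_smul, pNorm_four_smul, abs_of_pos (inv_pos.2 h0), inv_mul_le_iff₀ h0] at h1
    rw [mul_comm ρ]
    exact h1.trans (by gcongr)

lemma sum_mulVec_sq_le {n : ℕ} {A : Matrix (Fin n) (Fin n) ℝ} (hs : A.IsSymm) {ρ : ℝ}
    (hA : opNorm 4 A ≤ ρ) (v : Fin n → ℝ) : ∑ i, A.mulVec v i ^ 2 ≤ ρ ^ 2 * ∑ i, v i ^ 2 := by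
  have hH : A.IsHermitian := by
    rw [Matrix.IsHermitian, Matrix.conjTranspose_eq_transpose_of_trivial]; exact hs
  have hev : ∀ j, hH.eigenvalues j ^ 2 ≤ ρ ^ 2 := by
    intro j
    have h1 := hH.mulVec_eigenvectorBasis j
    have h2 := sum_mulVec_pow_four_le hA (hH.eigenvectorBasis j)
    rw [h1] at h2
    simp only [Pi.smul_apply, smul_eq_mul, mul_pow, ← Finset.mul_sum] at h2
    have h3 : 0 < ∑ i, (hH.eigenvectorBasis j) i ^ 4 := by
      refine (Finset.sum_nonneg fun i _ => by positivity).lt_of_ne fun h => ?_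
      have h4 := (Finset.sum_eq_zero_iff_of_nonneg fun i _ => by positivity).1 h.symm
      refine hH.eigenvectorBasis.toBasis.ne_zero j ?_
      rw [OrthonormalBasis.coe_toBasis]
      ext i
      exact pow_eq_zero_iff (by norm_num) |>.1 (h4 i (Finset.mem_univ i))
    have h5 := le_of_mul_le_mul_right h2 h3
    nlinarith [sq_nonneg (hH.eigenvalues j), sq_nonneg ρ]
  set x : EuclideanSpace ℝ (Fin n) := WithLp.toLp 2 v with hx
  set y : EuclideanSpace ℝ (Fin n) := WithLp.toLp 2 (A.mulVec v) with hy
  have hin : ∀ j, inner ℝ (hH.eigenvectorBasis j) y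
      = hH.eigenvalues j * inner ℝ (hH.eigenvectorBasis j) x := by
    intro j
    have h1 := hH.mulVec_eigenvectorBasis j
    have h2 : inner ℝ (hH.eigenvectorBasis j) y = A.mulVec v ⬝ᵥ ⇑(hH.eigenvectorBasis j) := by
      simp [EuclideanSpace.inner_eq_star_dotProduct, hy]
    have h3 : inner ℝ (hH.eigenvectorBasis j) x = v ⬝ᵥ ⇑(hH.eigenvectorBasis j) := by
      simp [EuclideanSpace.inner_eq_star_dotProduct, hx]
    rw [h2, h3, dotProduct_comm, Matrix.dotProduct_mulVec, ← Matrix.mulVec_transpose, hs.eq, h1,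
      smul_dotProduct, dotProduct_comm, smul_eq_mul]
  have hx2 := hH.eigenvectorBasis.sum_sq_norm_inner_right x
  have hy2 := hH.eigenvectorBasis.sum_sq_norm_inner_right y
  rw [EuclideanSpace.norm_sq_eq] at hx2 hy2
  simp only [Real.norm_eq_abs, sq_abs, hx, hy] at hx2 hy2
  rw [← hx2, ← hy2, Finset.mul_sum]
  refine Finset.sum_le_sum fun j _ => ?_
  have := hin j
  rw [hx, hy] at this
  rw [this, mul_pow]
  exact mul_le_mul_of_nonneg_right (hev j) (sq_nonneg _)

lemma sum_row_sq_le_alphaMax {n : ℕ} (A : Matrix (Fin n) (Fin n) ℝ) (i : Fin n) :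
    ∑ j, A i j ^ 2 ≤ alphaMax A :=
  le_ciSup (f := fun i => ∑ j, A i j ^ 2) (finite_range _).bddAbove i

lemma alphaMax_nonneg {n : ℕ} (A : Matrix (Fin n) (Fin n) ℝ) : 0 ≤ alphaMax A :=
  Real.iSup_nonneg fun _ => Finset.sum_nonneg fun _ _ => sq_nonneg _

lemma alphaMax_le_one {n : ℕ} {A : Matrix (Fin n) (Fin n) ℝ} (hs : A.IsSymm) {ρ : ℝ} (hρ : 0 ≤ ρ)
    (hρ1 : ρ ≤ 1) (hA : opNorm 4 A ≤ ρ) : alphaMax A ≤ 1 := by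
  refine Real.iSup_le (fun i => ?_) zero_le_one
  have h := sum_mulVec_sq_le hs hA (Pi.single i 1)
  simp only [Matrix.mulVec_single_one] at h
  have h2 : ∑ j, (Pi.single i 1 : Fin n → ℝ) j ^ 2 = 1 := by
    rw [Finset.sum_eq_single i] <;> simp +contextual
  rw [h2, mul_one] at h
  calc ∑ j, A i j ^ 2 = ∑ j, A.col i j ^ 2 :=
        Finset.sum_congr rfl fun j _ => by rw [Matrix.col_apply, hs.apply]
    _ ≤ ρ ^ 2 := h
    _ ≤ 1 := pow_le_one₀ hρ hρ1

/-! ### The Gibbs measure as a spin system -/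

/-- Resampling one coordinate preserves a product measure. -/
lemma measurePreserving_update {ι : Type*} [Fintype ι] [DecidableEq ι] {X : ι → Type*}
    [∀ i, MeasurableSpace (X i)] (μ : ∀ i, Measure (X i)) [∀ i, IsProbabilityMeasure (μ i)] (i : ι) :
    MeasurePreserving (fun z : (∀ j, X j) × X i => Function.update z.1 i z.2)
      ((Measure.pi μ).prod (μ i)) (Measure.pi μ) := by
  have hm : Measurable fun z : (∀ j, X j) × X i => Function.update z.1 i z.2 :=
    measurable_pi_lambda _ fun j => by
      by_cases h : j = i
      · subst h; simpa using measurable_snd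
      · simp only [Function.update_of_ne h]
        exact (measurable_pi_apply j).comp measurable_fst
  refine ⟨hm, (Measure.pi_eq fun s hs => ?_).symm⟩
  rw [Measure.map_apply hm (MeasurableSet.univ_pi hs)]
  have hpre : (fun z : (∀ j, X j) × X i => Function.update z.1 i z.2) ⁻¹' (Set.pi univ s)
      = (Set.pi univ (Function.update s i univ)) ×ˢ s i := by
    ext ⟨σ, x⟩
    simp only [mem_preimage, mem_univ_pi, mem_prod]
    constructor
    · refine fun h => ⟨fun j => ?_, by simpa using h i⟩
      by_cases hj : j = i
      · subst hj; simp
      · simpa [hj] using h j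
    · rintro ⟨h1, h2⟩ j
      by_cases hj : j = i
      · subst hj; simpa using h2
      · simpa [hj] using h1 j
  rw [hpre, Measure.prod_prod, Measure.pi_pi, ← Finset.mul_prod_erase _ _ (Finset.mem_univ i),
    ← Finset.mul_prod_erase Finset.univ (fun j => μ j (s j)) (Finset.mem_univ i),
    Function.update_self, measure_univ, one_mul, mul_comm]
  congr 1
  refine Finset.prod_congr rfl fun j hj => ?_
  rw [Function.update_of_ne (Finset.ne_of_mem_erase hj)]

lemma ham_update {n : ℕ} {A : Matrix (Fin n) (Fin n) ℝ} (hs : A.IsSymm) (hd : ∀ i, A i i = 0)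
    (c σ : Fin n → ℝ) (i : Fin n) (x : ℝ) :
    ham A c (Function.update σ i x)
      = ham A c (Function.update σ i 0) + (A.mulVec σ i + c i) * x := by
  set τ := Function.update σ i 0 with hτ
  have h1 : Function.update σ i x = Function.update τ i x := by simp [hτ]
  have h2 : A.mulVec τ i = A.mulVec σ i := by rw [hτ, SpinSystem.field_update, hd]; simp
  have h3 : τ i = 0 := by simp [hτ]
  have hsum : ∀ g : Fin n → ℝ, ∑ k, Function.update τ i x k * g k = ∑ k, τ k * g k + x * g i := by
    intro g
    rw [← sub_eq_iff_eq_add', ← Finset.sum_sub_distrib, Finset.sum_eq_single i]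
    · simp [h3]
    · intro k _ hk; simp [hk]
    · simp
  have hA : ∑ k, τ k * (A k i * x) = A.mulVec τ i * x := by
    rw [Matrix.mulVec, dotProduct, Finset.sum_mul]
    exact Finset.sum_congr rfl fun k _ => by rw [hs.apply]; ring
  unfold ham
  simp only [mul_comm (c _)]
  rw [h1, hsum c]
  simp only [SpinSystem.field_update τ i x, h3, sub_zero]
  rw [hsum]
  simp only [mul_add, Finset.sum_add_distrib, hA, hd, h2]
  ring

lemma continuous_ham {n : ℕ} (A : Matrix (Fin n) (Fin n) ℝ) (c : Fin n → ℝ) :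
    Continuous (ham A c) := by
  have := SpinSystem.continuous_field (A := A)
  unfold ham; fun_prop

section Gibbs

variable {n : ℕ} {μ : Fin n → Measure ℝ} {A : Matrix (Fin n) (Fin n) ℝ}

lemma ae_pi_abs_le_one (hμ : ∀ i, GoodBase (μ i)) : ∀ᵐ σ ∂Measure.pi μ, ∀ i, |σ i| ≤ 1 := by
  have := fun i => (hμ i).prob
  exact ae_all_iff.2 fun i =>
    (Measure.quasiMeasurePreserving_eval μ i).ae (hμ i).ae_abs_le

lemma integrable_exp_ham (hμ : ∀ i, GoodBase (μ i)) (c : Fin n → ℝ) :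
    Integrable (fun σ => Real.exp (ham A c σ)) (Measure.pi μ) :=
  have := fun i => (hμ i).prob
  integrable_of_ae_abs_le_one (ae_pi_abs_le_one hμ) (Real.continuous_exp.comp (continuous_ham A c))

lemma isProbabilityMeasure_gibbs (hμ : ∀ i, GoodBase (μ i)) (c : Fin n → ℝ) :
    IsProbabilityMeasure (gibbs μ A c) := by
  have := fun i => (hμ i).prob
  have hi := integrable_exp_ham (A := A) hμ c
  have hZ := integral_exp_pos hi
  refine ⟨?_⟩
  rw [gibbs, Measure.smul_apply, withDensity_apply _ MeasurableSet.univ, Measure.restrict_univ,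
    ← ofReal_integral_eq_lintegral_ofReal hi (ae_of_all _ fun σ => (Real.exp_pos _).le),
    smul_eq_mul, ENNReal.inv_mul_cancel (by simpa using hZ) ENNReal.ofReal_ne_top]

lemma ae_gibbs_abs_le_one (hμ : ∀ i, GoodBase (μ i)) (c : Fin n → ℝ) :
    ∀ᵐ σ ∂gibbs μ A c, ∀ i, |σ i| ≤ 1 :=
  Measure.ae_smul_measure ((withDensity_absolutelyContinuous _ _).ae_le (ae_pi_abs_le_one hμ)) _

lemma integral_gibbs (c : Fin n → ℝ) (F : (Fin n → ℝ) → ℝ) :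
    ∫ σ, F σ ∂gibbs μ A c
      = ((ENNReal.ofReal (∫ σ, Real.exp (ham A c σ) ∂(Measure.pi μ)))⁻¹).toReal
        * ∫ σ, Real.exp (ham A c σ) * F σ ∂Measure.pi μ := by
  rw [gibbs, integral_smul_measure, integral_withDensity_eq_integral_toReal_smul
    (by have := (continuous_ham A c).measurable; fun_prop)
    (ae_of_all _ fun σ => ENNReal.ofReal_lt_top)]
  simp only [smul_eq_mul, ENNReal.toReal_ofReal (Real.exp_pos _).le]

/-- Functions of one spin that are centred under its conditional law integrate to zero. -/
lemma integral_gibbs_eq_zero (hμ : ∀ i, GoodBase (μ i)) (hs : A.IsSymm) (hd : ∀ i, A i i = 0)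
    (c : Fin n → ℝ) (i : Fin n) {k : ℝ → ℝ → ℝ} (hk : Continuous (Function.uncurry k))
    (h0 : ∀ θ, ∫ x, k x θ * Real.exp (θ * x) ∂μ i = 0) {g : (Fin n → ℝ) → ℝ} (hg : Continuous g)
    (hgi : ∀ σ x, g (Function.update σ i x) = g σ) :
    ∫ σ, k (σ i) (A.mulVec σ i + c i) * g σ ∂gibbs μ A c = 0 := by
  have := fun i => (hμ i).prob
  have hfield := SpinSystem.continuous_field (A := A) i
  have hham := continuous_ham A c
  set F : (Fin n → ℝ) → ℝ := fun σ =>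
    Real.exp (ham A c σ) * (k (σ i) (A.mulVec σ i + c i) * g σ) with hF
  have hFc : Continuous F := by
    have : Continuous fun σ : Fin n → ℝ => k (σ i) (A.mulVec σ i + c i) :=
      hk.comp ((continuous_apply i).prodMk (hfield.add continuous_const))
    fun_prop
  have hmp := measurePreserving_update μ i
  have hFi : Integrable (fun z : (Fin n → ℝ) × ℝ => F (Function.update z.1 i z.2))
      ((Measure.pi μ).prod (μ i)) :=
    hmp.integrable_comp_of_integrable (integrable_of_ae_abs_le_one (ae_pi_abs_le_one hμ) hFc)
  have hup : ∀ σ x, F (Function.update σ i x)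
      = Real.exp (ham A c (Function.update σ i 0)) * g σ
        * (k x (A.mulVec σ i + c i) * Real.exp ((A.mulVec σ i + c i) * x)) := by
    intro σ x
    simp only [hF]
    rw [ham_update hs hd, Real.exp_add, hgi, SpinSystem.field_update, hd, Function.update_self,
      zero_mul, add_zero]
    ring
  have h1 : ∫ σ, F σ ∂Measure.pi μ = 0 := by
    rw [← hmp.map_eq, integral_map hmp.measurable.aemeasurable hFc.aestronglyMeasurable,
      integral_prod _ hFi]
    simp only [hup, integral_const_mul, h0, mul_zero, integral_zero]
  rw [integral_gibbs, h1, mul_zero]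

lemma spinSystem_gibbs (hμ : ∀ i, GoodBase (μ i)) (hs : A.IsSymm) (hd : ∀ i, A i i = 0) {ρ : ℝ}
    (hρ : ρ ∈ Ioo (0 : ℝ) 1) (hA : opNorm 4 A ≤ ρ) (c : Fin n → ℝ) :
    SpinSystem A c (fun i => psiD (μ i)) (fun i => psiDD (μ i)) ρ (alphaMax A) (gibbs μ A c) := by
  have hψ : ∀ i, Continuous (psiD (μ i)) := fun i =>
    continuous_iff_continuousAt.2 fun x => ((hμ i).hasDerivAt_psiD x).continuousAt
  have hψ' : ∀ i, Continuous (psiDD (μ i)) := fun i =>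
    (LipschitzWith.of_dist_le_mul (K := 4) fun x y => by
      simpa [Real.dist_eq] using (hμ i).abs_psiDD_sub_le x y).continuous
  exact
  { prob := isProbabilityMeasure_gibbs hμ c
    cube := ae_gibbs_abs_le_one hμ c
    hasDeriv := fun i => (hμ i).hasDerivAt_psiD
    p_le := fun i => (hμ i).abs_psiD_le
    p'_nonneg := fun i => (hμ i).psiDD_nonneg
    p'_le := fun i => (hμ i).psiDD_le
    lip := fun i => (hμ i).abs_psiDD_sub_le
    mean := fun i g hg hgi => integral_gibbs_eq_zero hμ hs hd c i
      (k := fun x θ => x - psiD (μ i) θ) (by have := hψ i; fun_prop)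
      (hμ i).integral_sub_psiD_mul_exp hg hgi
    var := fun i g hg hgi => integral_gibbs_eq_zero hμ hs hd c i
      (k := fun x θ => (x - psiD (μ i) θ) ^ 2 - psiDD (μ i) θ)
      (by have := hψ i; have := hψ' i; fun_prop)
      (hμ i).integral_sub_psiD_sq_sub_psiDD_mul_exp hg hgi
    symm := fun i j => hs.apply j i
    diag := hd
    rho_pos := hρ.1
    rho_lt := hρ.2
    l2 := sum_mulVec_sq_le hs hA
    l4 := sum_mulVec_pow_four_le hA
    row := sum_row_sq_le_alphaMax A
    al_nonneg := alphaMax_nonneg A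
    al_le := alphaMax_le_one hs hρ.1.le hρ.2.le hA }

end Gibbs

/-! ### Sup-norm facts and the main theorem -/

lemma abs_le_pNorm_top {n : ℕ} (q : Fin n → ℝ) (i : Fin n) : |q i| ≤ pNorm ∞ q := by
  rw [pNorm, if_pos rfl]
  exact le_ciSup (f := fun i => |q i|) (finite_range _).bddAbove i

lemma pNorm_top_le {n : ℕ} {q : Fin n → ℝ} {B : ℝ} (hB : 0 ≤ B) (h : ∀ i, |q i| ≤ B) :
    pNorm ∞ q ≤ B := by
  rw [pNorm, if_pos rfl]
  exact Real.iSup_le h hB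

lemma pNorm_top_pos {n : ℕ} {q : Fin n → ℝ} (hq : ∑ i, q i ^ 2 = 1) : 0 < pNorm ∞ q := by
  obtain ⟨i, -, hi⟩ := Finset.exists_ne_zero_of_sum_ne_zero (hq.trans_ne one_ne_zero)
  exact (abs_pos.2 (pow_ne_zero_iff (by norm_num) |>.1 hi)).trans_le (abs_le_pNorm_top q i)

/-- Collecting the error terms of the two steps of the proof. -/
lemma error_terms_le {a s H B r₁ r₂ r₃ r₄ e₁ e₂ b N d : ℝ} (ha : 0 ≤ a) (hs : 0 < s) (hH : 0 ≤ H)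
    (h₁ : 0 ≤ r₁) (h₂ : 0 ≤ r₂) (h₃ : 0 ≤ r₃) (h₄ : 0 ≤ r₄) (he₁ : 0 ≤ e₁) (he₂ : 0 ≤ e₂)
    (hb : 0 ≤ b) (hN : 0 ≤ N) (hd : 0 ≤ d) (hr₁ : r₁ ≤ 1) (hee : e₁ ≤ 2) (hHle : H ≤ a * (N + r₃))
    (hB : B ≤ 4 * H + (r₁ + e₁) / s * (8 + 4 * H + r₂) + r₄ + e₂) :
    d + H + B ≤ (1 + a + (4 * a + (9 + 12 * a) / s + 1)) *
      (r₂ * (r₁ + b + e₁) + r₁ + r₃ + N + d + r₄ + e₂ + e₁) := by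
  have h5 : 0 ≤ r₂ * (r₁ + e₁) := by positivity
  have h6 : 0 ≤ r₂ * b := by positivity
  set E := r₂ * (r₁ + b + e₁) + r₁ + r₃ + N + d + r₄ + e₂ + e₁ with hE
  have hE' : E = r₂ * (r₁ + e₁) + r₂ * b + r₁ + r₃ + N + d + r₄ + e₂ + e₁ := by rw [hE]; ring
  clear_value E
  have hHE : H ≤ a * E := hHle.trans (mul_le_mul_of_nonneg_left (by linarith) ha)
  have h7 : (r₁ + e₁) * H ≤ 3 * H := mul_le_mul_of_nonneg_right (by linarith) hH
  have h8 : (r₁ + e₁) / s * (8 + 4 * H + r₂) ≤ (9 + 12 * a) / s * E := by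
    rw [div_mul_eq_mul_div, div_mul_eq_mul_div]
    refine div_le_div_of_nonneg_right ?_ hs.le
    linarith
  linarith

/-- Berry–Esseen bound with explicit centering (Theorem 2.9(b)). -/
theorem berryEsseen_explicit_centering (ρ κ : ℝ) (hρ : ρ ∈ Set.Ioo (0 : ℝ) 1) (hκ : 0 < κ) :
    ∃ C : ℝ, 0 < C ∧
      ∀ n : ℕ, 0 < n → ∀ μ : Fin n → Measure ℝ, (∀ i, GoodBase (μ i)) →
      ∀ A : Matrix (Fin n) (Fin n) ℝ, A.IsSymm → (∀ i, A i i = 0) → opNorm 4 A ≤ ρ →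
      ∀ c q : Fin n → ℝ, pNorm 2 q = 1 → κ ≤ upsilonQ μ c q →
      ∀ lam : ℝ, |lam| ≤ ρ →
        dKS ((gibbs μ A c).map fun σ =>
              ∑ i, q i * (σ i - psiD (μ i) (c i) / (1 - lam * upsilonQ μ c q)))
            (gaussianReal 0 (Real.toNNReal (upsilonQ μ c q / (1 - lam * upsilonQ μ c q)))) ≤
          C * (Real.sqrt (R2 μ A c) * (Real.sqrt (R1 μ A c q) + Real.sqrt (alphaMax A) +
              pNorm 2 (epsVec A q lam)) +
            Real.sqrt (R1 μ A c q) + Real.sqrt (R3 μ A c) + Real.sqrt n * alphaMax A +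
            pNorm ∞ q + R4 μ A c q +
            |∑ i, epsVec A q lam i * psiD (μ i) (c i)| + pNorm 2 (epsVec A q lam)) := by
  have h1 : 0 < 1 - ρ := by linarith [hρ.2]
  obtain ⟨K, hK, hKS⟩ := SpinSystem.exists_dKS_le ρ κ hρ hκ
  set a := 500 / (1 - ρ) ^ 2 with ha
  have ha0 : 0 < a := by positivity
  refine ⟨K * (1 + a + (4 * a + (9 + 12 * a) / (1 - ρ) + 1)), by positivity, ?_⟩
  intro n _ μ hμ A hs hd hA c q hq hκυ lam hlam
  have S := spinSystem_gibbs hμ hs hd hρ hA c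
  rw [pNorm_two, Real.sqrt_eq_one] at hq
  set υ := upsilonQ μ c q with hυ
  set e := epsVec A q lam with he
  set r : Fin n → ℝ := A.mulVec fun j => q j * (psiDD (μ j) (c j) - υ) with hr
  have hυ0 : 0 < υ := hκ.trans_le hκυ
  have hυ1 : υ ≤ 1 := (S.sum_sq_mul_var_mem hq c).2
  have hR1 : R1 μ A c q = ∑ i, r i ^ 2 := by
    simp only [R1, hr, Matrix.mulVec, dotProduct, mul_assoc, ← hυ]
  have hR2 : R2 μ A c = ∑ i, A.mulVec (fun j => psiD (μ j) (c j)) i ^ 2 := rfl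
  have hR3 : R3 μ A c = ∑ i, A.mulVec (fun j => psiD (μ j) (c j)) i ^ 4 := rfl
  have hR4 : R4 μ A c q = |∑ i, r i * psiD (μ i) (c i)| := by
    rw [R4, Finset.sum_comm, ← hυ]
    simp only [hr, Matrix.mulVec, dotProduct, Finset.sum_mul]
    congr 1
    refine Finset.sum_congr rfl fun j _ => Finset.sum_congr rfl fun i _ => ?_
    rw [hs.apply]; ring
  have hR1le : √(∑ i, r i ^ 2) ≤ 1 := by
    have h2 := S.sqrt_sum_field_sq_le fun j => q j * (psiDD (μ j) (c j) - υ)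
    have h3 : √(∑ j, (q j * (psiDD (μ j) (c j) - υ)) ^ 2) ≤ 1 := by
      rw [Real.sqrt_le_one, ← hq]
      refine Finset.sum_le_sum fun j _ => ?_
      rw [mul_pow]
      refine mul_le_of_le_one_right (sq_nonneg _) ?_
      rw [sq_le_one_iff_abs_le_one, abs_le]
      constructor <;> linarith [(hμ j).psiDD_nonneg (c j), (hμ j).psiDD_le (c j)]
    exact h2.trans (mul_le_one₀ hρ.2.le (Real.sqrt_nonneg _) h3)
  have hele : √(∑ i, e i ^ 2) ≤ 2 := by
    have h2 := SpinSystem.sqrt_sum_sq_add_le (A.mulVec q) fun i => -lam * q i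
    have h3 := S.sqrt_sum_field_sq_le q
    simp only [mul_pow, ← Finset.mul_sum, hq, Real.sqrt_one, mul_one, neg_sq, Real.sqrt_sq_eq_abs,
      neg_mul, ← sub_eq_add_neg] at h2 h3
    have : √(∑ i, e i ^ 2) = √(∑ i, (A.mulVec q i - lam * q i) ^ 2) := rfl
    rw [this]
    linarith [hρ.2]
  have hqle : ∀ i, |q i| ≤ 1 := fun i => by
    rw [← sq_le_one_iff_abs_le_one, ← hq]
    exact Finset.single_le_sum (f := fun i => q i ^ 2) (fun i _ => sq_nonneg _) (Finset.mem_univ i)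
  have hδ0 := pNorm_top_pos hq
  have hs0 : 1 - lam * υ ≠ 0 := by
    have : lam * υ ≤ ρ := (le_abs_self _).trans (by
      rw [abs_mul, abs_of_pos hυ0]
      exact (mul_le_of_le_one_right (abs_nonneg _) hυ1).trans hlam)
    linarith
  have hB := S.integral_abs_linStat_sub_condSum_le (r := r) (e := e) (lam := lam) hq hυ0.le hυ1 hs0
    (fun _ => rfl) (fun _ => rfl)
  have hH := S.integral_fieldNorm_le
  have hmain := hKS S hδ0 (pNorm_top_le zero_le_one hqle) (abs_le_pNorm_top q) hq hυ hκυ hlam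
  refine hmain.trans ?_
  rw [mul_assoc]
  refine mul_le_mul_of_nonneg_left ?_ hK.le
  rw [pNorm_two, hR1, hR2, hR3, hR4]
  rw [← ha] at hH
  refine error_terms_le (by positivity) h1 (integral_nonneg fun σ => Real.sqrt_nonneg _)
    (Real.sqrt_nonneg _) (Real.sqrt_nonneg _) (Real.sqrt_nonneg _) (abs_nonneg _)
    (Real.sqrt_nonneg _) (abs_nonneg _) (Real.sqrt_nonneg _)
    (mul_nonneg (Real.sqrt_nonneg _) (alphaMax_nonneg A)) hδ0.le hR1le hele hH hB
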